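/- Let (5+√89)/8 < α < 2 and λ = λ₁ + iλ₂ with λ₂ > 0 and λ₂ ≥ α|λ₁|/(2√(α+1)), and let u be a Schwartz-class classical solution of equation (1.1) on [0,∞) with initial datum u₀ not identically zero. Then the limit lim_{t→∞} t^{1/α} sup_{x∈ℝ} |u(t,x)| exists and equals ( (2−α)/(2α λ₂) )^{1/α}; in particular it is independent of the initial datum. -/

import Mathlib

open MeasureTheory Real Set Filter

noncomputable section

/-- A Schwartz-class classical solution of equation (1.1),
`−i ∂_t u + c₂ ∂_x² u + i c₁ ∂_x u − c₀ u = λ |u|^α u`, on `[0,∞) × ℝ`. -/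
structure SchwartzSolution (c₂ c₁ c₀ α : ℝ) (lam : ℂ) (u : ℝ → ℝ → ℂ) where
  ut : ℝ → ℝ → ℂ
  ux : ℝ → ℝ → ℂ
  uxx : ℝ → ℝ → ℂ
  hut : ∀ x : ℝ, ∀ t ∈ Ici (0:ℝ), HasDerivWithinAt (fun s => u s x) (ut t x) (Ici 0) t
  hux : ∀ t ∈ Ici (0:ℝ), ∀ x : ℝ, HasDerivAt (fun y => u t y) (ux t x) x
  huxx : ∀ t ∈ Ici (0:ℝ), ∀ x : ℝ, HasDerivAt (fun y => ux t y) (uxx t x) x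
  hu_cont : ContinuousOn (fun p : ℝ × ℝ => u p.1 p.2) (Ici 0 ×ˢ univ)
  hut_cont : ContinuousOn (fun p : ℝ × ℝ => ut p.1 p.2) (Ici 0 ×ˢ univ)
  hux_cont : ContinuousOn (fun p : ℝ × ℝ => ux p.1 p.2) (Ici 0 ×ˢ univ)
  huxx_cont : ContinuousOn (fun p : ℝ × ℝ => uxx p.1 p.2) (Ici 0 ×ˢ univ)
  hdecay : ∀ n : ℕ, ∀ T : ℝ, 0 < T → ∃ C : ℝ, ∀ t ∈ Icc (0:ℝ) T, ∀ x : ℝ,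
    (‖u t x‖ + ‖ut t x‖ + ‖ux t x‖ + ‖uxx t x‖) * (1 + |x|) ^ n ≤ C
  heq : ∀ t : ℝ, 0 < t → ∀ x : ℝ,
    -Complex.I * ut t x + (c₂ : ℂ) * uxx t x + Complex.I * (c₁ : ℂ) * ux t x
      - (c₀ : ℂ) * u t x = lam * Complex.ofReal (‖u t x‖ ^ α) * u t x

/-- A bound `‖f‖ ≤ C / (1 + x²)` makes a continuous function integrable. -/
lemma integrable_of_norm_le_inv_one_add_sq {E : Type*} [NormedAddCommGroup E] {f : ℝ → E} {C : ℝ}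
    (hf : AEStronglyMeasurable f volume) (h : ∀ x, ‖f x‖ ≤ C * (1 + x ^ 2)⁻¹) :
    Integrable f :=
  (integrable_inv_one_add_sq.const_mul C).mono' hf (Eventually.of_forall h)

lemma inv_one_add_sq_le_one (x : ℝ) : (1 + x ^ 2)⁻¹ ≤ 1 :=
  inv_le_one_of_one_le₀ (by nlinarith [sq_nonneg x])

lemma inv_one_add_sq_nonneg (x : ℝ) : 0 ≤ (1 + x ^ 2)⁻¹ := by positivity

lemma mul_le_inv_one_add_sq {a b A B x : ℝ} (hb0 : 0 ≤ b)
    (ha : a ≤ A * (1 + x ^ 2)⁻¹) (hb : b ≤ B * (1 + x ^ 2)⁻¹) (hA : 0 ≤ A) (hB : 0 ≤ B) :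
    a * b ≤ A * B * (1 + x ^ 2)⁻¹ := by
  have h0 := inv_one_add_sq_nonneg x
  have h1 := inv_one_add_sq_le_one x
  have hb' : b ≤ B := hb.trans (by nlinarith)
  calc a * b ≤ (A * (1 + x ^ 2)⁻¹) * B := by gcongr
    _ = A * B * (1 + x ^ 2)⁻¹ := by ring

/-- Differentiation of a weighted mass under the integral sign. -/
lemma hasDerivAt_integral_norm_sq_mul {w wt : ℝ → ℝ → ℂ} {s : Set ℝ} {t C B : ℝ}
    (hs : s ∈ nhds t) (hd : ∀ r ∈ s, ∀ x, HasDerivAt (fun r => w r x) (wt r x) r)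
    (hw : ∀ r ∈ s, Continuous (w r)) (hwt : Continuous (wt t))
    (hwC : ∀ r ∈ s, ∀ x, ‖w r x‖ ≤ C * (1 + x ^ 2)⁻¹)
    (hwtC : ∀ r ∈ s, ∀ x, ‖wt r x‖ ≤ C * (1 + x ^ 2)⁻¹) (hC : 0 ≤ C)
    {φ : ℝ → ℝ} (hφ : Continuous φ) (hφB : ∀ x, |φ x| ≤ B) :
    HasDerivAt (fun r => ∫ x, ‖w r x‖ ^ 2 * φ x) (∫ x, 2 * inner ℝ (w t x) (wt t x) * φ x) t := by
  have ht : t ∈ s := mem_of_mem_nhds hs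
  have hB : 0 ≤ B := (abs_nonneg _).trans (hφB 0)
  refine (hasDerivAt_integral_of_dominated_loc_of_deriv_le (F := fun r x => ‖w r x‖ ^ 2 * φ x)
    (F' := fun r x => 2 * inner ℝ (w r x) (wt r x) * φ x)
    (bound := fun x => 2 * (C * C) * B * (1 + x ^ 2)⁻¹) hs ?_ ?_ ?_ ?_ ?_ ?_).2
  · filter_upwards [hs] with r hr
    exact (((hw r hr).norm.pow 2).mul hφ).aestronglyMeasurable
  · refine integrable_of_norm_le_inv_one_add_sq (C := C * C * B)
      ((((hw t ht).norm.pow 2).mul hφ).aestronglyMeasurable) fun x => ?_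
    rw [norm_mul, norm_pow, norm_norm, sq, Real.norm_eq_abs]
    have := mul_le_inv_one_add_sq (norm_nonneg _) (hwC t ht x) (hwC t ht x) hC hC
    calc ‖w t x‖ * ‖w t x‖ * |φ x| ≤ (C * C * (1 + x ^ 2)⁻¹) * B := by
          gcongr; exact hφB x
      _ = _ := by ring
  · exact (((continuous_const.mul ((hw t ht).inner hwt))).mul hφ).aestronglyMeasurable
  · refine Eventually.of_forall fun x r hr => ?_
    rw [norm_mul, norm_mul, Real.norm_eq_abs, Real.norm_eq_abs, Real.norm_eq_abs, abs_two]
    have h1 := abs_real_inner_le_norm (w r x) (wt r x)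
    have := mul_le_inv_one_add_sq (norm_nonneg _) (hwC r hr x) (hwtC r hr x) hC hC
    calc 2 * |inner ℝ (w r x) (wt r x)| * |φ x| ≤ 2 * (C * C * (1 + x ^ 2)⁻¹) * B := by
          gcongr
          · exact h1.trans this
          · exact hφB x
      _ = _ := by ring
  · exact integrable_inv_one_add_sq.const_mul _
  · refine Eventually.of_forall fun x r hr => ?_
    exact ((hd r hr x).norm_sq).mul_const _

/-- The mass flux of `-i f''` against a bounded weight, after one integration by parts. -/
lemma integral_inner_neg_I_mul_deriv₂ {f f' f'' : ℝ → ℂ} {C B : ℝ}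
    (hf : ∀ x, HasDerivAt f (f' x) x) (hf' : ∀ x, HasDerivAt f' (f'' x) x)
    (hf'' : Continuous f'')
    (hfC : ∀ x, ‖f x‖ ≤ C * (1 + x ^ 2)⁻¹) (hf'C : ∀ x, ‖f' x‖ ≤ C * (1 + x ^ 2)⁻¹)
    (hf''C : ∀ x, ‖f'' x‖ ≤ C * (1 + x ^ 2)⁻¹) (hC : 0 ≤ C)
    {φ φ' : ℝ → ℝ} (hφ : ∀ x, HasDerivAt φ (φ' x) x) (hφ' : Continuous φ')
    (hφB : ∀ x, |φ x| ≤ B) (hφ'B : ∀ x, |φ' x| ≤ B) :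
    ∫ x, inner ℝ (f x) (-Complex.I * f'' x) * φ x =
      -∫ x, inner ℝ (f x) (-Complex.I * f' x) * φ' x := by
  have cf : Continuous f := continuous_iff_continuousAt.2 fun x => (hf x).continuousAt
  have cf' : Continuous f' := continuous_iff_continuousAt.2 fun x => (hf' x).continuousAt
  have cφ : Continuous φ := continuous_iff_continuousAt.2 fun x => (hφ x).continuousAt
  have hB : 0 ≤ B := (abs_nonneg _).trans (hφB 0)
  have key : ∀ (p q : ℂ) (r x : ℝ), ‖p‖ ≤ C * (1 + x ^ 2)⁻¹ → ‖q‖ ≤ C * (1 + x ^ 2)⁻¹ → |r| ≤ B →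
      ‖inner ℝ p (-Complex.I * q) * r‖ ≤ C * C * B * (1 + x ^ 2)⁻¹ := by
    intro p q r x hp hq hr
    have h1 := abs_real_inner_le_norm p (-Complex.I * q)
    rw [norm_mul, norm_neg, Complex.norm_I, one_mul] at h1
    have := mul_le_inv_one_add_sq (norm_nonneg _) hp hq hC hC
    rw [norm_mul, Real.norm_eq_abs, Real.norm_eq_abs]
    calc |inner ℝ p (-Complex.I * q)| * |r| ≤ (C * C * (1 + x ^ 2)⁻¹) * B := by
          gcongr
          exact h1.trans this
      _ = _ := by ring
  have i1 : Integrable fun x => inner ℝ (f x) (-Complex.I * f'' x) * φ x :=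
    integrable_of_norm_le_inv_one_add_sq
      ((cf.inner (continuous_const.mul hf'')).mul cφ).aestronglyMeasurable
      fun x => key _ _ _ x (hfC x) (hf''C x) (hφB x)
  have i2 : Integrable fun x => inner ℝ (f x) (-Complex.I * f' x) * φ' x :=
    integrable_of_norm_le_inv_one_add_sq
      ((cf.inner (continuous_const.mul cf')).mul hφ').aestronglyMeasurable
      fun x => key _ _ _ x (hfC x) (hf'C x) (hφ'B x)
  have i3 : Integrable fun x => inner ℝ (f x) (-Complex.I * f' x) * φ x :=
    integrable_of_norm_le_inv_one_add_sq
      ((cf.inner (continuous_const.mul cf')).mul cφ).aestronglyMeasurable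
      fun x => key _ _ _ x (hfC x) (hf'C x) (hφB x)
  have hderiv : ∀ x, HasDerivAt (fun x => inner ℝ (f x) (-Complex.I * f' x) * φ x)
      (inner ℝ (f x) (-Complex.I * f'' x) * φ x + inner ℝ (f x) (-Complex.I * f' x) * φ' x) x := by
    intro x
    have h := ((hf x).inner ℝ ((hf' x).const_mul (-Complex.I))).mul (hφ x)
    have h0 : inner ℝ (f' x) (-Complex.I * f' x) = 0 := by
      simp [Complex.inner, Complex.mul_re, Complex.mul_im]; ring
    rw [h0, add_zero] at h
    exact h
  have := integral_eq_zero_of_hasDerivAt_of_integrable hderiv (i1.add i2) i3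
  rw [integral_add i1 i2] at this
  linarith

/-- The derivative of `‖f‖ ^ α • f` along a curve. -/
lemma hasDerivAt_norm_rpow_mul {f : ℝ → ℂ} {f' : ℂ} {x α : ℝ} (hα : 1 < α)
    (hf : HasDerivAt f f' x) :
    HasDerivAt (fun y => ((‖f y‖ ^ α : ℝ) : ℂ) * f y)
      (((α * ‖f x‖ ^ (α - 2) * inner ℝ (f x) f' : ℝ) : ℂ) * f x + ((‖f x‖ ^ α : ℝ) : ℂ) * f') x := by
  have h1 : HasDerivAt (fun y => ‖f y‖ ^ α) (α * ‖f x‖ ^ (α - 2) * inner ℝ (f x) f') x := by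
    have := (hasFDerivAt_norm_rpow (f x) hα).comp_hasDerivAt x hf
    simpa [Function.comp_def] using this
  exact h1.ofReal_comp.mul hf

/-- The pointwise inequality behind the dissipation of the gradient. -/
lemma inner_deriv_norm_rpow_mul_nonpos {α : ℝ} (hα : 1 < α) {lam : ℂ} (hlam0 : 0 < lam.im)
    (hlam : α * |lam.re| / (2 * Real.sqrt (α + 1)) ≤ lam.im) (z z' : ℂ) :
    inner ℝ z' (Complex.I * lam * (((α * ‖z‖ ^ (α - 2) * inner ℝ z z' : ℝ) : ℂ) * z
      + ((‖z‖ ^ α : ℝ) : ℂ) * z')) ≤ 0 := by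
  rcases eq_or_ne z 0 with rfl | hz
  · simp [Real.zero_rpow (by linarith : α ≠ 0)]
  have hz' : 0 < ‖z‖ := norm_pos_iff.2 hz
  have hr : ‖z‖ ^ α = ‖z‖ ^ (α - 2) * ‖z‖ ^ 2 := by
    rw [← Real.rpow_natCast, ← Real.rpow_add hz']; norm_num
  have hr0 : 0 ≤ ‖z‖ ^ (α - 2) := by positivity
  rw [hr]
  set r := ‖z‖ ^ (α - 2)
  have hn : ‖z‖ ^ 2 = z.re ^ 2 + z.im ^ 2 := by
    rw [← Complex.normSq_eq_norm_sq, Complex.normSq_apply]; ring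
  rw [hn]
  have hs : 0 < Real.sqrt (α + 1) := Real.sqrt_pos.2 (by linarith)
  have hs2 : Real.sqrt (α + 1) ^ 2 = α + 1 := Real.sq_sqrt (by linarith)
  rw [div_le_iff₀ (by positivity)] at hlam
  set s := Real.sqrt (α + 1)
  set p := z.re * z'.re + z.im * z'.im with hp
  set q := z.re * z'.im - z.im * z'.re with hq
  have hmain : lam.re * α * p * q ≤ lam.im * ((1 + α) * p ^ 2 + q ^ 2) := by
    calc lam.re * α * p * q ≤ |lam.re * α * p * q| := le_abs_self _
      _ = (α * |lam.re|) * (|p| * |q|) := by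
        rw [abs_mul, abs_mul, abs_mul, abs_of_pos (by linarith : 0 < α)]; ring
      _ ≤ (lam.im * (2 * s)) * (|p| * |q|) := by gcongr
      _ = lam.im * (2 * (s * |p|) * |q|) := by ring
      _ ≤ lam.im * ((s * |p|) ^ 2 + |q| ^ 2) := by
        gcongr; exact two_mul_le_add_sq _ _
      _ = _ := by rw [mul_pow, hs2, sq_abs, sq_abs]; ring
  have hid : inner ℝ z' (Complex.I * lam * (((α * r * inner ℝ z z' : ℝ) : ℂ) * z
      + ((r * (z.re ^ 2 + z.im ^ 2) : ℝ) : ℂ) * z')) =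
      r * (lam.re * α * p * q - lam.im * ((1 + α) * p ^ 2 + q ^ 2)) := by
    simp only [Complex.inner, Complex.mul_re, Complex.mul_im, Complex.add_re, Complex.add_im,
      Complex.conj_re, Complex.conj_im, Complex.I_re, Complex.I_im, Complex.ofReal_re,
      Complex.ofReal_im, hp, hq]
    ring
  rw [hid]
  exact mul_nonpos_of_nonneg_of_nonpos hr0 (by linarith)

/-- Integration by parts for the real inner product of decaying functions. -/
lemma integral_inner_deriv_eq_neg {f f' g g' : ℝ → ℂ} {A B : ℝ}
    (hf : ∀ x, HasDerivAt f (f' x) x) (hg : ∀ x, HasDerivAt g (g' x) x)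
    (hf' : AEStronglyMeasurable f' volume) (hg' : AEStronglyMeasurable g' volume)
    (hfA : ∀ x, ‖f x‖ ≤ A * (1 + x ^ 2)⁻¹) (hf'A : ∀ x, ‖f' x‖ ≤ A * (1 + x ^ 2)⁻¹)
    (hgB : ∀ x, ‖g x‖ ≤ B * (1 + x ^ 2)⁻¹) (hg'B : ∀ x, ‖g' x‖ ≤ B * (1 + x ^ 2)⁻¹)
    (hA : 0 ≤ A) (hB : 0 ≤ B) :
    ∫ x, inner ℝ (f' x) (g x) = -∫ x, inner ℝ (f x) (g' x) := by
  have cf : Continuous f := continuous_iff_continuousAt.2 fun x => (hf x).continuousAt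
  have cg : Continuous g := continuous_iff_continuousAt.2 fun x => (hg x).continuousAt
  have key : ∀ (p q : ℂ) (x : ℝ), ‖p‖ ≤ A * (1 + x ^ 2)⁻¹ → ‖q‖ ≤ B * (1 + x ^ 2)⁻¹ →
      ‖inner ℝ p q‖ ≤ A * B * (1 + x ^ 2)⁻¹ := fun p q x hp hq =>
    (abs_real_inner_le_norm p q).trans (mul_le_inv_one_add_sq (norm_nonneg _) hp hq hA hB)
  have i1 : Integrable fun x => inner ℝ (f' x) (g x) :=
    integrable_of_norm_le_inv_one_add_sq (hf'.inner cg.aestronglyMeasurable)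
      fun x => key _ _ x (hf'A x) (hgB x)
  have i2 : Integrable fun x => inner ℝ (f x) (g' x) :=
    integrable_of_norm_le_inv_one_add_sq (cf.aestronglyMeasurable.inner hg')
      fun x => key _ _ x (hfA x) (hg'B x)
  have i3 : Integrable fun x => inner ℝ (f x) (g x) :=
    integrable_of_norm_le_inv_one_add_sq (cf.inner cg).aestronglyMeasurable
      fun x => key _ _ x (hfA x) (hgB x)
  have := integral_eq_zero_of_hasDerivAt_of_integrable
    (fun x => (hf x).inner ℝ (hg x)) (i2.add i1) i3
  rw [integral_add i2 i1] at this
  linarith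

/-- A solution of the profile equation
`∂ₜ w = -i c t⁻² ∂ₓ² w + i λ t^{-α/2} |w|^α w`, `t > 0`, together with its derivatives. -/
structure ProfileSolution (c α : ℝ) (lam : ℂ) (w wt wx wxx : ℝ → ℝ → ℂ) : Prop where
  hasDerivAt_time : ∀ t, 0 < t → ∀ x, HasDerivAt (fun s => w s x) (wt t x) t
  hasDerivAt_space : ∀ t, 0 < t → ∀ x, HasDerivAt (w t) (wx t x) x
  hasDerivAt_space₂ : ∀ t, 0 < t → ∀ x, HasDerivAt (wx t) (wxx t x) x
  continuousAt_time : ∀ t, 0 < t → ∀ x, ContinuousAt (fun p : ℝ × ℝ => wt p.1 p.2) (t, x)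
  continuousAt_space₂ : ∀ t, 0 < t → ∀ x, ContinuousAt (fun p : ℝ × ℝ => wxx p.1 p.2) (t, x)
  decay : ∀ a b, 0 < a → ∃ C, ∀ t ∈ Icc a b, ∀ x,
    (‖w t x‖ + ‖wt t x‖ + ‖wx t x‖ + ‖wxx t x‖) * (1 + x ^ 2) ≤ C
  equation : ∀ t, 0 < t → ∀ x, wt t x = (c * (t ^ 2)⁻¹ : ℝ) * (-Complex.I * wxx t x)
    + (t ^ (-(α / 2)) : ℝ) * (Complex.I * lam * (((‖w t x‖ ^ α : ℝ) : ℂ) * w t x))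

namespace ProfileSolution

variable {c α : ℝ} {lam : ℂ} {w wt wx wxx : ℝ → ℝ → ℂ}

lemma exists_bound (h : ProfileSolution c α lam w wt wx wxx) {a b : ℝ} (ha : 0 < a) :
    ∃ C, 0 ≤ C ∧ ∀ t ∈ Icc a b, ∀ x, ‖w t x‖ ≤ C * (1 + x ^ 2)⁻¹ ∧
      ‖wt t x‖ ≤ C * (1 + x ^ 2)⁻¹ ∧ ‖wx t x‖ ≤ C * (1 + x ^ 2)⁻¹ ∧
      ‖wxx t x‖ ≤ C * (1 + x ^ 2)⁻¹ := by
  obtain ⟨C, hC⟩ := h.decay a b ha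
  refine ⟨max C 0, le_max_right _ _, fun t ht x => ?_⟩
  have h1 := (hC t ht x).trans (le_max_left C 0)
  rw [← le_div_iff₀ (by positivity), div_eq_mul_inv] at h1
  have h2 := norm_nonneg (w t x)
  have h3 := norm_nonneg (wt t x)
  have h4 := norm_nonneg (wx t x)
  have h5 := norm_nonneg (wxx t x)
  refine ⟨?_, ?_, ?_, ?_⟩ <;> linarith

lemma continuous_space (h : ProfileSolution c α lam w wt wx wxx) {t : ℝ} (ht : 0 < t) :
    Continuous (w t) :=
  continuous_iff_continuousAt.2 fun x => (h.hasDerivAt_space t ht x).continuousAt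

lemma continuous_wx (h : ProfileSolution c α lam w wt wx wxx) {t : ℝ} (ht : 0 < t) :
    Continuous (wx t) :=
  continuous_iff_continuousAt.2 fun x => (h.hasDerivAt_space₂ t ht x).continuousAt

lemma continuous_wt (h : ProfileSolution c α lam w wt wx wxx) {t : ℝ} (ht : 0 < t) :
    Continuous (wt t) :=
  continuous_iff_continuousAt.2 fun x =>
    (h.continuousAt_time t ht x).comp (f := fun y : ℝ => (t, y)) (by fun_prop)

lemma continuous_wxx (h : ProfileSolution c α lam w wt wx wxx) {t : ℝ} (ht : 0 < t) :
    Continuous (wxx t) :=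
  continuous_iff_continuousAt.2 fun x =>
    (h.continuousAt_space₂ t ht x).comp (f := fun y : ℝ => (t, y)) (by fun_prop)

lemma Icc_mem_nhds {t : ℝ} (ht : 0 < t) : Icc (t / 2) (2 * t) ∈ nhds t :=
  _root_.Icc_mem_nhds (by linarith) (by linarith)

lemma integrable_norm_sq (h : ProfileSolution c α lam w wt wx wxx) {t : ℝ} (ht : 0 < t) :
    Integrable fun x => ‖w t x‖ ^ 2 := by
  obtain ⟨C, hC, hb⟩ := h.exists_bound (b := t) ht
  refine integrable_of_norm_le_inv_one_add_sq (C := C * C)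
    ((h.continuous_space ht).norm.pow 2).aestronglyMeasurable fun x => ?_
  have := (hb t ⟨le_rfl, le_rfl⟩ x).1
  rw [norm_pow, norm_norm, sq]
  exact mul_le_inv_one_add_sq (norm_nonneg _) this this hC hC

lemma integrable_norm_sq_wx (h : ProfileSolution c α lam w wt wx wxx) {t : ℝ} (ht : 0 < t) :
    Integrable fun x => ‖wx t x‖ ^ 2 := by
  obtain ⟨C, hC, hb⟩ := h.exists_bound (b := t) ht
  refine integrable_of_norm_le_inv_one_add_sq (C := C * C)
    ((h.continuous_wx ht).norm.pow 2).aestronglyMeasurable fun x => ?_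
  have := (hb t ⟨le_rfl, le_rfl⟩ x).2.2.1
  rw [norm_pow, norm_norm, sq]
  exact mul_le_inv_one_add_sq (norm_nonneg _) this this hC hC

/-- The energy identity for the gradient; no mixed derivative of `w` is needed. -/
lemma hasDerivAt_integral_norm_sq_wx (h : ProfileSolution c α lam w wt wx wxx) {t : ℝ}
    (ht : 0 < t) :
    HasDerivAt (fun s => ∫ x, ‖wx s x‖ ^ 2) (-∫ x, inner ℝ (wt t x) (wxx t x + wxx t x)) t := by
  obtain ⟨C, hC, hb⟩ := h.exists_bound (a := t / 2) (b := 2 * t) (by linarith)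
  have htI : t ∈ Icc (t / 2) (2 * t) := mem_of_mem_nhds (Icc_mem_nhds ht)
  have hpos : ∀ s ∈ Icc (t / 2) (2 * t), 0 < s := fun s hs => by linarith [hs.1]
  have hdiff : ∀ s ∈ Icc (t / 2) (2 * t), (∫ x, ‖wx s x‖ ^ 2) - ∫ x, ‖wx t x‖ ^ 2 =
      -∫ x, inner ℝ (w s x - w t x) (wxx s x + wxx t x) := by
    intro s hs
    have h1 := integral_inner_deriv_eq_neg (A := C + C) (B := C + C)
      (fun x => (h.hasDerivAt_space s (hpos s hs) x).sub (h.hasDerivAt_space t ht x))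
      (fun x => (h.hasDerivAt_space₂ s (hpos s hs) x).add (h.hasDerivAt_space₂ t ht x))
      ((h.continuous_wx (hpos s hs)).sub (h.continuous_wx ht)).aestronglyMeasurable
      ((h.continuous_wxx (hpos s hs)).add (h.continuous_wxx ht)).aestronglyMeasurable
      (fun x => (norm_sub_le _ _).trans (by linarith [(hb s hs x).1, (hb t htI x).1]))
      (fun x => (norm_sub_le _ _).trans (by linarith [(hb s hs x).2.2.1, (hb t htI x).2.2.1]))
      (fun x => (norm_add_le _ _).trans (by linarith [(hb s hs x).2.2.1, (hb t htI x).2.2.1]))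
      (fun x => (norm_add_le _ _).trans (by linarith [(hb s hs x).2.2.2, (hb t htI x).2.2.2]))
      (by linarith) (by linarith)
    simp only [Pi.sub_apply, Pi.add_apply] at h1
    rw [← h1, ← integral_sub (h.integrable_norm_sq_wx (hpos s hs)) (h.integrable_norm_sq_wx ht)]
    refine integral_congr_ae (Eventually.of_forall fun x => ?_)
    simp only [inner_sub_left, inner_add_right, real_inner_self_eq_norm_sq]
    rw [real_inner_comm (wx s x) (wx t x)]
    ring
  rw [hasDerivAt_iff_tendsto_slope]
  have hslope : ∀ᶠ s in nhdsWithin t {t}ᶜ, -∫ x, inner ℝ ((s - t)⁻¹ • (w s x - w t x))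
      (wxx s x + wxx t x) = slope (fun s => ∫ x, ‖wx s x‖ ^ 2) t s := by
    filter_upwards [nhdsWithin_le_nhds (Icc_mem_nhds ht)] with s hs
    rw [slope_def_module, hdiff s hs]
    simp only [real_inner_smul_left, integral_const_mul, smul_eq_mul]
    ring
  refine Tendsto.congr' hslope (Tendsto.neg ?_)
  refine tendsto_integral_filter_of_dominated_convergence
    (fun x => C * (C + C) * (1 + x ^ 2)⁻¹) ?_ ?_ (integrable_inv_one_add_sq.const_mul _) ?_
  · filter_upwards [nhdsWithin_le_nhds (Icc_mem_nhds ht)] with s hs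
    exact (((continuous_const (y := (s - t)⁻¹)).smul
      ((h.continuous_space (hpos s hs)).sub (h.continuous_space ht))).inner
      ((h.continuous_wxx (hpos s hs)).add (h.continuous_wxx ht))).aestronglyMeasurable
  · filter_upwards [nhdsWithin_le_nhds (Icc_mem_nhds ht), self_mem_nhdsWithin] with s hs hne
    refine Eventually.of_forall fun x => ?_
    have h1 : ‖w s x - w t x‖ ≤ C * (1 + x ^ 2)⁻¹ * ‖s - t‖ :=
      (convex_Icc (t / 2) (2 * t)).norm_image_sub_le_of_norm_hasDerivWithin_le
        (f := fun s => w s x) (f' := fun s => wt s x)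
        (fun r hr => (h.hasDerivAt_time r (hpos r hr) x).hasDerivWithinAt)
        (fun r hr => (hb r hr x).2.1) htI hs
    have hst : 0 < ‖s - t‖ := norm_pos_iff.2 (sub_ne_zero.2 hne)
    refine (abs_real_inner_le_norm _ _).trans (mul_le_inv_one_add_sq (norm_nonneg _) ?_ ?_ hC
      (by linarith))
    · rw [norm_smul, norm_inv, inv_mul_le_iff₀ hst, mul_comm]
      exact h1
    · exact (norm_add_le _ _).trans (by linarith [(hb s hs x).2.2.2, (hb t htI x).2.2.2])
  · refine Eventually.of_forall fun x => ?_
    have h1 := hasDerivAt_iff_tendsto_slope.1 (h.hasDerivAt_time t ht x)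
    simp only [slope_fun_def, vsub_eq_sub] at h1
    have h2 : Tendsto (fun s => wxx s x) (nhdsWithin t {t}ᶜ) (nhds (wxx t x)) :=
      ((h.continuousAt_space₂ t ht x).comp (f := fun s : ℝ => (s, x))
        (by fun_prop)).tendsto.mono_left nhdsWithin_le_nhds
    exact h1.inner (h2.add_const _)

/-- The dissipation condition makes the `L²` norm of the gradient nonincreasing. -/
lemma antitoneOn_integral_norm_sq_wx (h : ProfileSolution c α lam w wt wx wxx) (hα : 1 < α)
    (hlam0 : 0 < lam.im) (hlam : α * |lam.re| / (2 * Real.sqrt (α + 1)) ≤ lam.im) :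
    AntitoneOn (fun s => ∫ x, ‖wx s x‖ ^ 2) (Ioi 0) := by
  refine antitoneOn_of_hasDerivWithinAt_nonpos (convex_Ioi 0)
    (fun t ht => (h.hasDerivAt_integral_norm_sq_wx ht).continuousAt.continuousWithinAt)
    (fun t ht => (h.hasDerivAt_integral_norm_sq_wx
      (interior_subset ht)).hasDerivWithinAt) fun t ht => ?_
  replace ht : 0 < t := interior_subset ht
  obtain ⟨C, hC, hb⟩ := h.exists_bound (b := t) ht
  replace hb := fun x => hb t ⟨le_rfl, le_rfl⟩ x
  set N : ℝ → ℂ := fun y => ((‖w t y‖ ^ α : ℝ) : ℂ) * w t y with hN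
  set N' : ℝ → ℂ := fun y => ((α * ‖w t y‖ ^ (α - 2) * inner ℝ (w t y) (wx t y) : ℝ) : ℂ) * w t y
    + ((‖w t y‖ ^ α : ℝ) : ℂ) * wx t y with hN'
  have hNd : ∀ x, HasDerivAt N (N' x) x := fun x =>
    hasDerivAt_norm_rpow_mul hα (h.hasDerivAt_space t ht x)
  have hwC : ∀ x, ‖w t x‖ ≤ C := fun x =>
    (hb x).1.trans (mul_le_of_le_one_right hC (inv_one_add_sq_le_one x))
  have hCα : 0 ≤ C ^ α := by positivity
  have hNb : ∀ x, ‖N x‖ ≤ (α + 1) * (C ^ α * C) * (1 + x ^ 2)⁻¹ := fun x => by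
    rw [hN, norm_mul, Complex.norm_real, Real.norm_of_nonneg (by positivity)]
    calc ‖w t x‖ ^ α * ‖w t x‖ ≤ C ^ α * (C * (1 + x ^ 2)⁻¹) := by
          gcongr
          exacts [hwC x, (hb x).1]
      _ = 1 * (C ^ α * C) * (1 + x ^ 2)⁻¹ := by ring
      _ ≤ _ := by gcongr; linarith
  have hN'b : ∀ x, ‖N' x‖ ≤ (α + 1) * (C ^ α * C) * (1 + x ^ 2)⁻¹ := fun x => by
    have h1 : ‖((α * ‖w t x‖ ^ (α - 2) * inner ℝ (w t x) (wx t x) : ℝ) : ℂ) * w t x‖ ≤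
        α * (‖w t x‖ ^ α * ‖wx t x‖) := by
      rw [norm_mul, Complex.norm_real, norm_mul, norm_mul, Real.norm_of_nonneg (by linarith),
        Real.norm_of_nonneg (by positivity)]
      rcases eq_or_ne (w t x) 0 with h0 | h0
      · simp [h0, Real.zero_rpow (by linarith : α ≠ 0)]
      have hr : ‖w t x‖ ^ α = ‖w t x‖ ^ (α - 2) * ‖w t x‖ ^ 2 := by
        rw [← Real.rpow_natCast, ← Real.rpow_add (norm_pos_iff.2 h0)]; norm_num
      rw [hr]
      calc α * ‖w t x‖ ^ (α - 2) * ‖inner ℝ (w t x) (wx t x)‖ * ‖w t x‖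
          ≤ α * ‖w t x‖ ^ (α - 2) * (‖w t x‖ * ‖wx t x‖) * ‖w t x‖ := by
            gcongr; exact abs_real_inner_le_norm _ _
        _ = _ := by ring
    have h2 : ‖((‖w t x‖ ^ α : ℝ) : ℂ) * wx t x‖ = ‖w t x‖ ^ α * ‖wx t x‖ := by
      rw [norm_mul, Complex.norm_real, Real.norm_of_nonneg (by positivity)]
    calc ‖N' x‖ ≤ α * (‖w t x‖ ^ α * ‖wx t x‖) + ‖w t x‖ ^ α * ‖wx t x‖ :=
          (norm_add_le _ _).trans (add_le_add h1 h2.le)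
      _ = (α + 1) * (‖w t x‖ ^ α * ‖wx t x‖) := by ring
      _ ≤ (α + 1) * (C ^ α * (C * (1 + x ^ 2)⁻¹)) := by
          gcongr
          exacts [hwC x, (hb x).2.2.1]
      _ = _ := by ring
  have mw := (h.continuous_space ht).measurable
  have mwx := (h.continuous_wx ht).measurable
  have mN' : Measurable N' := by
    have := mw.norm.pow_const (α - 2)
    have := mw.norm.pow_const α
    have := mw.inner (𝕜 := ℝ) mwx
    fun_prop
  have ibp := integral_inner_deriv_eq_neg (A := ‖lam‖ * ((α + 1) * (C ^ α * C))) (B := C)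
    (fun x => (hNd x).const_mul (Complex.I * lam)) (h.hasDerivAt_space₂ t ht)
    (mN'.const_mul _).aestronglyMeasurable (h.continuous_wxx ht).aestronglyMeasurable
    (fun x => by
      rw [norm_mul, norm_mul, Complex.norm_I, one_mul, mul_assoc]
      gcongr; exact hNb x)
    (fun x => by
      rw [norm_mul, norm_mul, Complex.norm_I, one_mul, mul_assoc]
      gcongr; exact hN'b x)
    (fun x => (hb x).2.2.1) (fun x => (hb x).2.2.2) (by positivity) hC
  have hfint : ∫ x, inner ℝ (wt t x) (wxx t x + wxx t x) =
      2 * t ^ (-(α / 2)) * ∫ x, inner ℝ (Complex.I * lam * N x) (wxx t x) := by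
    rw [← integral_const_mul]
    refine integral_congr_ae (Eventually.of_forall fun x => ?_)
    have hNx : ((‖w t x‖ ^ α : ℝ) : ℂ) * w t x = N x := rfl
    have h0 : inner ℝ (-Complex.I * wxx t x) (wxx t x) = 0 := by
      simp [Complex.inner, Complex.mul_re, Complex.mul_im]; ring
    simp only [h.equation t ht x, hNx]
    simp only [← Complex.real_smul, inner_add_left, inner_add_right, real_inner_smul_left, h0]
    ring
  have hneg : ∫ x, inner ℝ (Complex.I * lam * N' x) (wx t x) ≤ 0 :=
    integral_nonpos fun x => by
      rw [real_inner_comm]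
      exact inner_deriv_norm_rpow_mul_nonpos hα hlam0 hlam _ _
  rw [hfint]
  have : 0 ≤ t ^ (-(α / 2)) := by positivity
  rw [ibp] at hneg
  have := mul_nonneg this (by linarith : 0 ≤ ∫ x, inner ℝ (Complex.I * lam * N x) (wxx t x))
  linarith

end ProfileSolution

lemma exists_bump : ∃ (φ φ' : ℝ → ℝ) (B : ℝ), 0 < B ∧ (∀ x, HasDerivAt φ (φ' x) x) ∧
    Continuous φ' ∧ (∀ x, 0 ≤ φ x) ∧ (∀ x, φ x ≤ 1) ∧ (∀ x, |φ' x| ≤ B) ∧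
    (∀ x, |x| ≤ 1 → φ x = 1) ∧ ∀ x, 2 ≤ |x| → φ x = 0 := by
  let f : ContDiffBump (0 : ℝ) := ⟨1, 2, one_pos, one_lt_two⟩
  have hf : ContDiff ℝ 1 f := f.contDiff
  have hc : Continuous (deriv f) := hf.continuous_deriv le_rfl
  obtain ⟨B, hB⟩ := f.hasCompactSupport.deriv.exists_bound_of_continuous hc
  refine ⟨f, deriv f, max B 1, by positivity, fun x =>
    (hf.differentiable one_ne_zero x).hasDerivAt, hc, fun x => f.nonneg, fun x => f.le_one,
    fun x => (hB x).trans (le_max_left _ _), fun x hx => f.one_of_mem_closedBall ?_, fun x hx =>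
    f.zero_of_le_dist ?_⟩
  · simpa using hx
  · simpa using hx

/-- Cutoffs to large intervals with uniformly bounded slopes. -/
lemma exists_cutoff : ∃ B : ℝ, 0 < B ∧ ∀ R : ℝ, 1 ≤ R → ∃ φ φ' : ℝ → ℝ,
    (∀ x, HasDerivAt φ (φ' x) x) ∧ Continuous φ' ∧ (∀ x, 0 ≤ φ x) ∧ (∀ x, φ x ≤ 1) ∧
    (∀ x, |φ' x| ≤ B) ∧ (∀ x, |x| ≤ R → φ x = 1) ∧ ∀ x, 2 * R ≤ |x| → φ x = 0 := by
  obtain ⟨φ, φ', B, hB, hd, hc, h0, h1, hb, hone, hzero⟩ := exists_bump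
  refine ⟨B, hB, fun R hR => ⟨fun x => φ (x / R), fun x => φ' (x / R) * (1 / R), fun x => ?_,
    by fun_prop, fun x => h0 _, fun x => h1 _, fun x => ?_, fun x hx => hone _ ?_,
    fun x hx => hzero _ ?_⟩⟩
  · exact (hd (x / R)).comp x ((hasDerivAt_id x).div_const R)
  · rw [abs_mul, abs_of_nonneg (by positivity : 0 ≤ 1 / R)]
    exact (mul_le_of_le_one_right (abs_nonneg _)
      (by rw [div_le_one (by linarith)]; exact hR)).trans (hb _)
  · rw [abs_div, abs_of_pos (by linarith : 0 < R)]
    exact div_le_one_of_le₀ hx (by linarith)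
  · rw [abs_div, abs_of_pos (by linarith : 0 < R), le_div_iff₀ (by linarith)]
    exact hx

/-- Normalized bumps at scale `h` around an arbitrary point. -/
lemma exists_mollifier : ∃ B : ℝ, 0 < B ∧ ∀ ξ h : ℝ, 0 < h → ∃ φ φ' : ℝ → ℝ,
    (∀ x, HasDerivAt φ (φ' x) x) ∧ Continuous φ' ∧ (∀ x, 0 ≤ φ x) ∧ (∀ x, φ x ≤ B * h⁻¹) ∧
    (∀ x, |φ' x| ≤ B * (h ^ 2)⁻¹) ∧ (∀ x, h ≤ |x - ξ| → φ x = 0) ∧ Integrable φ ∧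
    ∫ x, φ x = 1 := by
  obtain ⟨φ, φ', B, hB, hd, hc, h0, h1, hb, hone, hzero⟩ := exists_bump
  have cφ : Continuous φ := continuous_iff_continuousAt.2 fun x => (hd x).continuousAt
  have hcs : HasCompactSupport φ := HasCompactSupport.of_support_subset_isCompact
    (isCompact_Icc (a := -2) (b := 2)) fun x hx => by
      by_contra hx2
      refine hx (hzero x ?_)
      rw [← not_lt, abs_lt]
      exact fun h => hx2 ⟨h.1.le, h.2.le⟩
  have hfint : Integrable φ := cφ.integrable_of_hasCompactSupport hcs
  set J := ∫ x, φ x with hJ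
  have hJpos : 0 < J := cφ.integral_pos_of_hasCompactSupport_nonneg_nonzero hcs h0
    (x := 0) (by rw [hone 0 (by simp)]; exact one_ne_zero)
  refine ⟨J⁻¹ * 4 * (B + 1), by positivity, fun ξ h hh =>
    ⟨fun x => J⁻¹ * (2 / h) * φ ((x - ξ) * (2 / h)),
      fun x => J⁻¹ * (2 / h) * (φ' ((x - ξ) * (2 / h)) * (1 * (2 / h))), fun x => ?_,
    by fun_prop, fun x => by have := h0 ((x - ξ) * (2 / h)); positivity,
    fun x => ?_, fun x => ?_, fun x hx => ?_, ?_, ?_⟩⟩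
  · exact ((hd _).comp x (((hasDerivAt_id x).sub_const ξ).mul_const (2 / h))).const_mul _
  · calc J⁻¹ * (2 / h) * φ ((x - ξ) * (2 / h)) ≤ J⁻¹ * (2 / h) * 1 := by gcongr; exact h1 _
      _ = J⁻¹ * 2 * 1 * h⁻¹ := by ring
      _ ≤ J⁻¹ * 4 * (B + 1) * h⁻¹ := by gcongr <;> linarith
  · rw [abs_mul, abs_of_pos (by positivity : 0 < J⁻¹ * (2 / h)), abs_mul (φ' _),
      abs_of_pos (by positivity : 0 < 1 * (2 / h))]
    calc J⁻¹ * (2 / h) * (|φ' ((x - ξ) * (2 / h))| * (1 * (2 / h)))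
        ≤ J⁻¹ * (2 / h) * (B * (1 * (2 / h))) := by gcongr; exact hb _
      _ = J⁻¹ * 4 * B * (h ^ 2)⁻¹ := by field_simp; ring
      _ ≤ J⁻¹ * 4 * (B + 1) * (h ^ 2)⁻¹ := by gcongr; linarith
  · simp only
    rw [hzero, mul_zero]
    rw [abs_mul, abs_of_pos (by positivity : 0 < 2 / h), mul_div_assoc', le_div_iff₀ hh]
    linarith
  · have h2 : 2 / h ≠ 0 := by positivity
    exact (((integrable_comp_mul_right_iff φ h2).2 hfint).comp_sub_right ξ).const_mul _
  · rw [integral_const_mul, integral_sub_right_eq_self (fun x => φ (x * (2 / h))) ξ,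
      Measure.integral_comp_mul_right, ← hJ, abs_of_pos (by positivity), smul_eq_mul]
    field_simp

namespace ProfileSolution

variable {c α : ℝ} {lam : ℂ} {w wt wx wxx : ℝ → ℝ → ℂ}

lemma integrable_norm_rpow_mul_norm_sq (h : ProfileSolution c α lam w wt wx wxx) (hα : 0 < α)
    {t : ℝ} (ht : 0 < t) : Integrable fun x => ‖w t x‖ ^ α * ‖w t x‖ ^ 2 := by
  obtain ⟨C, hC, hb⟩ := h.exists_bound (b := t) ht
  refine Integrable.bdd_mul (c := C ^ α) (h.integrable_norm_sq ht)
    ((h.continuous_space ht).norm.rpow_const fun _ => Or.inr hα.le).aestronglyMeasurable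
    (Eventually.of_forall fun x => ?_)
  rw [Real.norm_of_nonneg (by positivity)]
  gcongr
  exact (hb t ⟨le_rfl, le_rfl⟩ x).1.trans (mul_le_of_le_one_right hC (inv_one_add_sq_le_one x))

/-- The local mass balance: the linear flux contributes at most `O(t⁻²)`. -/
lemma exists_hasDerivAt_local_mass (h : ProfileSolution c α lam w wt wx wxx) (hα : 0 < α)
    (hc : 0 < c) {t : ℝ} (ht : 0 < t) {φ φ' : ℝ → ℝ} {A B : ℝ}
    (hφ : ∀ x, HasDerivAt φ (φ' x) x) (hφ' : Continuous φ')
    (hφA : ∀ x, |φ x| ≤ A) (hφB : ∀ x, |φ' x| ≤ B) :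
    ∃ P', HasDerivAt (fun s => ∫ x, ‖w s x‖ ^ 2 * φ x) P' t ∧
      |P' + 2 * lam.im * t ^ (-(α / 2)) * ∫ x, ‖w t x‖ ^ α * ‖w t x‖ ^ 2 * φ x| ≤
        c * (t ^ 2)⁻¹ * B * ((∫ x, ‖w t x‖ ^ 2) + ∫ x, ‖wx t x‖ ^ 2) := by
  obtain ⟨C, hC, hb⟩ := h.exists_bound (a := t / 2) (b := 2 * t) (by linarith)
  have htI : t ∈ Icc (t / 2) (2 * t) := mem_of_mem_nhds (Icc_mem_nhds ht)
  have hpos : ∀ s ∈ Icc (t / 2) (2 * t), 0 < s := fun s hs => by linarith [hs.1]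
  have cφ : Continuous φ := continuous_iff_continuousAt.2 fun x => (hφ x).continuousAt
  have hB : 0 ≤ B := (abs_nonneg _).trans (hφB 0)
  refine ⟨_, hasDerivAt_integral_norm_sq_mul (Icc_mem_nhds ht)
    (fun r hr x => h.hasDerivAt_time r (hpos r hr) x) (fun r hr => h.continuous_space (hpos r hr))
    (h.continuous_wt ht) (fun r hr x => (hb r hr x).1) (fun r hr x => (hb r hr x).2.1) hC cφ hφA, ?_⟩
  replace hb := fun x => hb t htI x
  have hflux := integral_inner_neg_I_mul_deriv₂ (B := max A B) (h.hasDerivAt_space t ht)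
    (h.hasDerivAt_space₂ t ht) (h.continuous_wxx ht) (fun x => (hb x).1) (fun x => (hb x).2.2.1)
    (fun x => (hb x).2.2.2) hC hφ hφ' (fun x => (hφA x).trans (le_max_left _ _))
    (fun x => (hφB x).trans (le_max_right _ _))
  have i1 : Integrable fun x => inner ℝ (w t x) (-Complex.I * wxx t x) * φ x := by
    refine Integrable.mul_bdd (c := A) ?_ cφ.aestronglyMeasurable (Eventually.of_forall hφA)
    refine integrable_of_norm_le_inv_one_add_sq (C := C * C) ((h.continuous_space ht).inner
      (continuous_const.mul (h.continuous_wxx ht))).aestronglyMeasurable fun x => ?_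
    refine (abs_real_inner_le_norm _ _).trans ?_
    rw [norm_mul, norm_neg, Complex.norm_I, one_mul]
    exact mul_le_inv_one_add_sq (norm_nonneg _) (hb x).1 (hb x).2.2.2 hC hC
  have i2 : Integrable fun x => ‖w t x‖ ^ α * ‖w t x‖ ^ 2 * φ x :=
    (h.integrable_norm_rpow_mul_norm_sq hα ht).mul_bdd cφ.aestronglyMeasurable
      (Eventually.of_forall hφA)
  have hP : ∫ x, 2 * inner ℝ (w t x) (wt t x) * φ x =
      2 * (c * (t ^ 2)⁻¹) * (∫ x, inner ℝ (w t x) (-Complex.I * wxx t x) * φ x)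
        - 2 * lam.im * t ^ (-(α / 2)) * ∫ x, ‖w t x‖ ^ α * ‖w t x‖ ^ 2 * φ x := by
    rw [← integral_const_mul, ← integral_const_mul,
      ← integral_sub (i1.const_mul _) (i2.const_mul _)]
    refine integral_congr_ae (Eventually.of_forall fun x => ?_)
    have h0 : inner ℝ (w t x) (Complex.I * lam * (((‖w t x‖ ^ α : ℝ) : ℂ) * w t x)) =
        -lam.im * (‖w t x‖ ^ α * ‖w t x‖ ^ 2) := by
      have hn : ‖w t x‖ ^ 2 = (w t x).re ^ 2 + (w t x).im ^ 2 := by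
        rw [← Complex.normSq_eq_norm_sq, Complex.normSq_apply]; ring
      rw [hn]
      simp only [Complex.inner, Complex.mul_re, Complex.mul_im, Complex.conj_re, Complex.conj_im,
        Complex.I_re, Complex.I_im, Complex.ofReal_re, Complex.ofReal_im]
      ring
    simp only [h.equation t ht x]
    rw [← Complex.real_smul, ← Complex.real_smul, inner_add_right, real_inner_smul_right,
      real_inner_smul_right, h0]
    ring
  rw [hP, hflux]
  have hbd : |∫ x, inner ℝ (w t x) (-Complex.I * wx t x) * φ' x| ≤
      B / 2 * ((∫ x, ‖w t x‖ ^ 2) + ∫ x, ‖wx t x‖ ^ 2) := by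
    rw [← integral_add (h.integrable_norm_sq ht) (h.integrable_norm_sq_wx ht),
      ← integral_const_mul, ← Real.norm_eq_abs]
    refine norm_integral_le_of_norm_le
      (((h.integrable_norm_sq ht).add (h.integrable_norm_sq_wx ht)).const_mul _)
      (Eventually.of_forall fun x => ?_)
    have h1 := abs_real_inner_le_norm (w t x) (-Complex.I * wx t x)
    rw [norm_mul, norm_neg, Complex.norm_I, one_mul] at h1
    rw [norm_mul, Real.norm_eq_abs, Real.norm_eq_abs]
    calc |inner ℝ (w t x) (-Complex.I * wx t x)| * |φ' x|
        ≤ ((‖w t x‖ ^ 2 + ‖wx t x‖ ^ 2) / 2) * B := by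
          gcongr
          · exact h1.trans (by linarith [two_mul_le_add_sq ‖w t x‖ ‖wx t x‖])
          · exact hφB x
      _ = _ := by ring
  set F := ∫ x, inner ℝ (w t x) (-Complex.I * wx t x) * φ' x
  set S := (∫ x, ‖w t x‖ ^ 2) + ∫ x, ‖wx t x‖ ^ 2
  have e : 2 * (c * (t ^ 2)⁻¹) * -F - 2 * lam.im * t ^ (-(α / 2)) *
      (∫ x, ‖w t x‖ ^ α * ‖w t x‖ ^ 2 * φ x) + 2 * lam.im * t ^ (-(α / 2)) *
      (∫ x, ‖w t x‖ ^ α * ‖w t x‖ ^ 2 * φ x) = 2 * (c * (t ^ 2)⁻¹) * -F := by ring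
  rw [e, abs_mul, abs_neg, abs_of_pos (by positivity)]
  calc 2 * (c * (t ^ 2)⁻¹) * |F| ≤ 2 * (c * (t ^ 2)⁻¹) * (B / 2 * S) := by gcongr
    _ = _ := by ring

/-- The mass is nonincreasing, with an explicit derivative. -/
lemma hasDerivAt_mass (h : ProfileSolution c α lam w wt wx wxx) (hα : 0 < α) (hc : 0 < c)
    {t : ℝ} (ht : 0 < t) :
    HasDerivAt (fun s => ∫ x, ‖w s x‖ ^ 2)
      (-(2 * lam.im * t ^ (-(α / 2)) * ∫ x, ‖w t x‖ ^ α * ‖w t x‖ ^ 2)) t := by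
  obtain ⟨P', hP, hb⟩ := h.exists_hasDerivAt_local_mass hα hc ht (φ := fun _ => 1)
    (φ' := fun _ => 0) (A := 1) (B := 0) (fun x => hasDerivAt_const x 1) continuous_const
    (fun _ => by simp) (fun _ => by simp)
  simp only [mul_one, mul_zero, zero_mul, abs_nonpos_iff] at hP hb
  rwa [← eq_neg_of_add_eq_zero_left hb]

lemma antitoneOn_mass (h : ProfileSolution c α lam w wt wx wxx) (hα : 0 < α) (hc : 0 < c)
    (hlam0 : 0 < lam.im) : AntitoneOn (fun s => ∫ x, ‖w s x‖ ^ 2) (Ioi 0) := by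
  refine antitoneOn_of_hasDerivWithinAt_nonpos (convex_Ioi 0)
    (fun t ht => (h.hasDerivAt_mass hα hc ht).continuousAt.continuousWithinAt)
    (fun t ht => (h.hasDerivAt_mass hα hc (interior_subset ht)).hasDerivWithinAt)
    fun t ht => ?_
  replace ht : 0 < t := interior_subset ht
  have : 0 ≤ ∫ x, ‖w t x‖ ^ α * ‖w t x‖ ^ 2 := integral_nonneg fun x => by positivity
  have := mul_nonneg (by positivity : 0 ≤ 2 * lam.im * t ^ (-(α / 2))) this
  linarith

/-- Hölder continuity of order `1/2` in space, from the gradient bound. -/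
lemma norm_sub_le (h : ProfileSolution c α lam w wt wx wxx) {t S d x y : ℝ} (ht : 0 < t)
    (hS : ∫ x, ‖wx t x‖ ^ 2 ≤ S) (hd : 0 < d) (hxy : |x - y| ≤ d) :
    ‖w t x - w t y‖ ≤ (S + 1) * √d := by
  wlog hle : y ≤ x generalizing x y
  · rw [norm_sub_rev]
    exact this (by rwa [abs_sub_comm]) (le_of_not_ge hle)
  rw [abs_of_nonneg (by linarith)] at hxy
  have cwx := h.continuous_wx ht
  have hs : 0 < √d := Real.sqrt_pos.2 hd
  rw [← intervalIntegral.integral_eq_sub_of_hasDerivAt (f := w t) (f' := wx t)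
    (fun z _ => h.hasDerivAt_space t ht z) (cwx.intervalIntegrable _ _)]
  have hpt : ∀ z, ‖wx t z‖ ≤ √d * ‖wx t z‖ ^ 2 + (√d)⁻¹ := fun z => by
    have h1 : (√d * ‖wx t z‖) * 1 ≤ (√d * ‖wx t z‖) ^ 2 + 1 := by
      nlinarith [sq_nonneg (√d * ‖wx t z‖ - 1)]
    have h2 : √d * ‖wx t z‖ ≤ √d * (√d * ‖wx t z‖ ^ 2 + (√d)⁻¹) := by
      rw [mul_add, mul_inv_cancel₀ hs.ne']; nlinarith
    exact le_of_mul_le_mul_left h2 hs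
  calc ‖∫ z in y..x, wx t z‖ ≤ ∫ z in y..x, ‖wx t z‖ :=
        intervalIntegral.norm_integral_le_integral_norm hle
    _ ≤ ∫ z in y..x, (√d * ‖wx t z‖ ^ 2 + (√d)⁻¹) :=
        intervalIntegral.integral_mono_on hle (cwx.norm.intervalIntegrable _ _)
          (((continuous_const.mul (cwx.norm.pow 2)).add continuous_const).intervalIntegrable _ _)
          fun z _ => hpt z
    _ = √d * (∫ z in y..x, ‖wx t z‖ ^ 2) + (x - y) * (√d)⁻¹ := by
        rw [intervalIntegral.integral_add
          (Continuous.intervalIntegrable (by fun_prop) _ _)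
          (continuous_const.intervalIntegrable _ _), intervalIntegral.integral_const_mul,
          intervalIntegral.integral_const, smul_eq_mul]
    _ ≤ √d * S + d * (√d)⁻¹ := by
        gcongr
        rw [intervalIntegral.integral_of_le hle]
        exact (setIntegral_le_integral (h.integrable_norm_sq_wx ht)
          (Eventually.of_forall fun z => by positivity)).trans hS
    _ = (S + 1) * √d := by
        have : d * (√d)⁻¹ = √d := by
          rw [← div_eq_mul_inv, Real.div_sqrt]
        rw [this]; ring

end ProfileSolution

/-- The explicit solutions of `Q' = -κ t^{-α/2} Q^{1+α/2}`. -/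
lemma hasDerivAt_barrier {α q b t : ℝ} (hα : 0 < α) (ht : 0 < t)
    (hpos : 0 < q + b * t ^ (1 - α / 2)) :
    HasDerivAt (fun s => (q + b * s ^ (1 - α / 2)) ^ (-(2 / α)))
      (-(2 / α * b * (1 - α / 2)) * t ^ (-(α / 2)) *
        ((q + b * t ^ (1 - α / 2)) ^ (-(2 / α))) ^ (1 + α / 2)) t := by
  have h1 : HasDerivAt (fun s => q + b * s ^ (1 - α / 2))
      (b * ((1 - α / 2) * t ^ (1 - α / 2 - 1))) t :=
    ((Real.hasDerivAt_rpow_const (Or.inl ht.ne')).const_mul b).const_add q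
  have h2 := h1.rpow_const (p := -(2 / α)) (Or.inl hpos.ne')
  convert h2 using 1
  rw [← Real.rpow_mul hpos.le]
  have e1 : -(2 / α) * (1 + α / 2) = -(2 / α) - 1 := by field_simp; ring
  have e2 : 1 - α / 2 - 1 = -(α / 2) := by ring
  rw [e1, e2]
  ring

lemma barrier_le_barrier {α q b s t : ℝ} (hα : 0 < α) (hα2 : α < 2) (hb : 0 < b) (hs : 0 < s)
    (hst : s ≤ t) (hpos : 0 < q + b * s ^ (1 - α / 2)) :
    (q + b * t ^ (1 - α / 2)) ^ (-(2 / α)) ≤ (q + b * s ^ (1 - α / 2)) ^ (-(2 / α)) := by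
  have : s ^ (1 - α / 2) ≤ t ^ (1 - α / 2) := Real.rpow_le_rpow hs.le hst (by linarith)
  refine Real.rpow_le_rpow_of_nonpos hpos (by gcongr) ?_
  have := div_pos two_pos hα
  linarith

lemma sqrt_rpow_mul_self {α Q : ℝ} (hQ : 0 < Q) : √Q ^ α * Q = Q ^ (1 + α / 2) := by
  rw [Real.sqrt_eq_rpow, ← Real.rpow_mul hQ.le, Real.rpow_add hQ, Real.rpow_one]
  ring_nf

/-- Comparison with the barrier from above. -/
lemma le_barrier_of_perturbed_ode {α L b δ o E T t₁ : ℝ} {P P' X : ℝ → ℝ} (hα : 0 < α)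
    (hα2 : α < 2) (hL : 0 < L) (hδ : 0 < δ) (hδ1 : δ < 1) (hT : 0 < T) (hTt : T < t₁)
    (hb : 0 < b) (hbL : 2 / α * b * (1 - α / 2) = 2 * L * ((1 - δ) ^ α - δ))
    (ho : o ≤ δ * √((1 + b * t₁ ^ (1 - α / 2)) ^ (-(2 / α))))
    (hE : E < 2 * L * δ * t₁ ^ (-(α / 2)) *
      ((1 + b * t₁ ^ (1 - α / 2)) ^ (-(2 / α))) ^ (1 + α / 2))
    (hP : ∀ t ∈ Icc T t₁, HasDerivAt P (P' t) t)
    (hPE : ∀ t ∈ Icc T t₁, |P' t + 2 * L * t ^ (-(α / 2)) * X t| ≤ E)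
    (hX : ∀ t ∈ Icc T t₁, (max (√(P t) - o) 0) ^ α * P t ≤ X t) :
    P t₁ ≤ (b * (t₁ ^ (1 - α / 2) - T ^ (1 - α / 2))) ^ (-(2 / α)) := by
  set γ := 1 - α / 2 with hγ
  have hγ0 : 0 < γ := by rw [hγ]; linarith
  set V := max (P T) 1
  have hV1 : 1 ≤ V := le_max_right _ _
  set v := V ^ (-(α / 2)) with hv
  have hv0 : 0 < v := by positivity
  have hv1 : v ≤ 1 := Real.rpow_le_one_of_one_le_of_nonpos hV1 (by linarith)
  have hvV : v ^ (-(2 / α)) = V := by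
    rw [hv, ← Real.rpow_mul (by positivity)]
    have : -(α / 2) * -(2 / α) = 1 := by field_simp
    rw [this, Real.rpow_one]
  set q := v - b * T ^ γ with hq
  have hbase : ∀ t ∈ Icc T t₁, v ≤ q + b * t ^ γ := fun t ht => by
    have : T ^ γ ≤ t ^ γ := Real.rpow_le_rpow hT.le ht.1 hγ0.le
    have := mul_le_mul_of_nonneg_left this hb.le
    linarith
  have hpos : ∀ t ∈ Icc T t₁, 0 < q + b * t ^ γ := fun t ht => hv0.trans_le (hbase t ht)
  have hmem : ∀ t ∈ Icc T t₁, 0 < t := fun t ht => hT.trans_le ht.1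
  have ht₁ : t₁ ∈ Icc T t₁ := ⟨hTt.le, le_rfl⟩
  have hbT : 0 < b * T ^ γ := by positivity
  have hm : ∀ t ∈ Icc T t₁, (1 + b * t₁ ^ γ) ^ (-(2 / α)) ≤ (q + b * t ^ γ) ^ (-(2 / α)) := by
    intro t ht
    refine le_trans ?_ (barrier_le_barrier hα hα2 hb (hmem t ht) ht.2 (hpos t ht))
    refine Real.rpow_le_rpow_of_nonpos (hpos t₁ ht₁) (by linarith) ?_
    have := div_pos two_pos hα
    linarith
  have hcmp := image_le_of_deriv_right_lt_deriv_boundary' (f := P) (f' := P')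
    (B := fun s => (q + b * s ^ γ) ^ (-(2 / α)))
    (fun t ht => (hP t ht).continuousAt.continuousWithinAt)
    (fun t ht => (hP t (Ico_subset_Icc_self ht)).hasDerivWithinAt)
    (by
      have : q + b * T ^ γ = v := by rw [hq]; ring
      simp only [this, hvV]
      exact le_max_left _ _)
    (fun t ht => (hasDerivAt_barrier hα (hmem t ht)
      (hpos t ht)).continuousAt.continuousWithinAt)
    (fun t ht => (hasDerivAt_barrier hα (hmem t (Ico_subset_Icc_self ht))
      (hpos t (Ico_subset_Icc_self ht))).hasDerivWithinAt)
    (fun t ht heq => by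
      replace ht := Ico_subset_Icc_self ht
      have h0 := hmem t ht
      have hQ0 : 0 < (q + b * t ^ γ) ^ (-(2 / α)) := Real.rpow_pos_of_pos (hpos t ht) _
      have hQm := hm t ht
      rw [hbL]
      have hX' := hX t ht
      have hPE' := (abs_le.1 (hPE t ht)).2
      rw [heq] at hX'
      set Q := (q + b * t ^ γ) ^ (-(2 / α))
      set m := (1 + b * t₁ ^ γ) ^ (-(2 / α))
      have hm0 : 0 < m := by
        have := hT.trans hTt
        positivity
      have ho' : o ≤ δ * √Q := ho.trans (by gcongr)
      have hX2 : (1 - δ) ^ α * Q ^ (1 + α / 2) ≤ X t := by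
        refine le_trans ?_ hX'
        have h1δ : 0 ≤ 1 - δ := by linarith
        rw [← sqrt_rpow_mul_self hQ0, ← mul_assoc, ← Real.mul_rpow h1δ (by positivity)]
        gcongr
        · refine le_trans ?_ (le_max_left _ _)
          linarith
      have hE2 : E < 2 * L * δ * t ^ (-(α / 2)) * Q ^ (1 + α / 2) := by
        refine hE.trans_le ?_
        gcongr ?_ * ?_
        · gcongr ?_ * ?_
          exact Real.rpow_le_rpow_of_nonpos h0 ht.2 (by linarith)
        · exact Real.rpow_le_rpow hm0.le hQm (by linarith)
      have hc : 0 < 2 * L * t ^ (-(α / 2)) := by positivity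
      have := mul_le_mul_of_nonneg_left hX2 hc.le
      linarith) ht₁
  refine hcmp.trans (Real.rpow_le_rpow_of_nonpos ?_ ?_ ?_)
  · have : T ^ γ < t₁ ^ γ := Real.rpow_lt_rpow hT.le hTt hγ0
    exact mul_pos hb (by linarith)
  · rw [hq]; linarith
  · have := div_pos two_pos hα
    linarith

/-- Comparison with the barrier from below. -/
lemma barrier_le_of_perturbed_ode {α L b δ o E q T t₁ : ℝ} {P P' X : ℝ → ℝ} (hα : 0 < α)
    (hα2 : α < 2) (hL : 0 < L) (hδ : 0 < δ) (hT : 0 < T) (hTt : T < t₁)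
    (hb : 0 < b) (hbL : 2 / α * b * (1 - α / 2) = 2 * L * ((1 + δ) ^ α + δ)) (hq : 0 < q)
    (ho0 : 0 ≤ o)
    (ho : o ≤ δ * √((q + b * t₁ ^ (1 - α / 2)) ^ (-(2 / α))))
    (hE : E < 2 * L * δ * t₁ ^ (-(α / 2)) *
      ((q + b * t₁ ^ (1 - α / 2)) ^ (-(2 / α))) ^ (1 + α / 2))
    (hP : ∀ t ∈ Icc T t₁, HasDerivAt P (P' t) t)
    (hPE : ∀ t ∈ Icc T t₁, |P' t + 2 * L * t ^ (-(α / 2)) * X t| ≤ E)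
    (hX : ∀ t ∈ Icc T t₁, X t ≤ (√(P t) + o) ^ α * P t)
    (hPT : q ^ (-(2 / α)) ≤ P T) :
    (q + b * t₁ ^ (1 - α / 2)) ^ (-(2 / α)) ≤ P t₁ := by
  set γ := 1 - α / 2 with hγ
  have hγ0 : 0 < γ := by rw [hγ]; linarith
  have hmem : ∀ t ∈ Icc T t₁, 0 < t := fun t ht => hT.trans_le ht.1
  have hpos : ∀ t ∈ Icc T t₁, 0 < q + b * t ^ γ := fun t ht => by
    have := hmem t ht
    positivity
  have ht₁ : t₁ ∈ Icc T t₁ := ⟨hTt.le, le_rfl⟩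
  have h2α : 0 < 2 / α := by positivity
  exact image_le_of_deriv_right_lt_deriv_boundary'
    (f := fun s => (q + b * s ^ γ) ^ (-(2 / α))) (B := P) (B' := P')
    (fun t ht => (hasDerivAt_barrier hα (hmem t ht)
      (hpos t ht)).continuousAt.continuousWithinAt)
    (fun t ht => (hasDerivAt_barrier hα (hmem t (Ico_subset_Icc_self ht))
      (hpos t (Ico_subset_Icc_self ht))).hasDerivWithinAt)
    (le_trans (Real.rpow_le_rpow_of_nonpos hq (by
      have : 0 < b * T ^ γ := by positivity
      linarith) (by linarith)) hPT)
    (fun t ht => (hP t ht).continuousAt.continuousWithinAt)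
    (fun t ht => (hP t (Ico_subset_Icc_self ht)).hasDerivWithinAt)
    (fun t ht heq => by
      replace ht := Ico_subset_Icc_self ht
      have h0 := hmem t ht
      have hQ0 : 0 < (q + b * t ^ γ) ^ (-(2 / α)) := Real.rpow_pos_of_pos (hpos t ht) _
      have hQm := barrier_le_barrier hα hα2 hb h0 ht.2 (hpos t ht)
      have hm0 : 0 < (q + b * t₁ ^ γ) ^ (-(2 / α)) := Real.rpow_pos_of_pos (hpos t₁ ht₁) _
      rw [hbL]
      have hX' := hX t ht
      have hPE' := (abs_le.1 (hPE t ht)).1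
      rw [← heq] at hX'
      set Q := (q + b * t ^ γ) ^ (-(2 / α))
      set m := (q + b * t₁ ^ γ) ^ (-(2 / α))
      have ho' : o ≤ δ * √Q := ho.trans (by gcongr)
      have hX2 : X t ≤ (1 + δ) ^ α * Q ^ (1 + α / 2) := by
        refine hX'.trans ?_
        rw [← sqrt_rpow_mul_self hQ0, ← mul_assoc, ← Real.mul_rpow (by positivity) (by positivity)]
        gcongr
        linarith
      have hE2 : E < 2 * L * δ * t ^ (-(α / 2)) * Q ^ (1 + α / 2) := by
        refine hE.trans_le ?_
        gcongr ?_ * ?_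
        · gcongr ?_ * ?_
          exact Real.rpow_le_rpow_of_nonpos h0 ht.2 (by linarith)
        · exact Real.rpow_le_rpow hm0.le hQm (by linarith)
      have hc : 0 < 2 * L * t ^ (-(α / 2)) := by positivity
      have := mul_le_mul_of_nonneg_left hX2 hc.le
      linarith) ht₁

/-- Averaging a pointwise two-sided bound against a probability density. -/
lemma integral_mul_mem_Icc {f g φ : ℝ → ℝ} {a b : ℝ} (hg : Integrable fun x => g x * φ x)
    (hfg : Integrable fun x => f x * (g x * φ x))
    (h : ∀ x, 0 ≤ g x * φ x ∧ (g x * φ x ≠ 0 → a ≤ f x ∧ f x ≤ b)) :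
    a * (∫ x, g x * φ x) ≤ ∫ x, f x * (g x * φ x) ∧
      ∫ x, f x * (g x * φ x) ≤ b * ∫ x, g x * φ x := by
  rw [← integral_const_mul, ← integral_const_mul]
  refine ⟨integral_mono (hg.const_mul a) hfg fun x => ?_,
    integral_mono hfg (hg.const_mul b) fun x => ?_⟩
  · by_cases h0 : g x * φ x = 0
    · simp [h0]
    · exact mul_le_mul_of_nonneg_right ((h x).2 h0).1 (h x).1
  · by_cases h0 : g x * φ x = 0
    · simp [h0]
    · exact mul_le_mul_of_nonneg_right ((h x).2 h0).2 (h x).1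

namespace ProfileSolution

variable {c α : ℝ} {lam : ℂ} {w wt wx wxx : ℝ → ℝ → ℂ}

/-- Local averages of `|w|²` at scale `h` almost satisfy a closed differential equation. -/
lemma exists_local_average (h : ProfileSolution c α lam w wt wx wxx) (hα : 1 < α)
    (hc : 0 < c) (hlam0 : 0 < lam.im)
    (hlam : α * |lam.re| / (2 * Real.sqrt (α + 1)) ≤ lam.im) :
    ∃ A E : ℝ, 0 < A ∧ 0 < E ∧ ∀ ξ d : ℝ, 0 < d → ∃ P P' X : ℝ → ℝ, ∀ t, 1 ≤ t →
      HasDerivAt P (P' t) t ∧ 0 ≤ P t ∧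
      |P' t + 2 * lam.im * t ^ (-(α / 2)) * X t| ≤ E * (t ^ 2)⁻¹ * (d ^ 2)⁻¹ ∧
      (max (√(P t) - A * √d) 0) ^ α * P t ≤ X t ∧ X t ≤ (√(P t) + A * √d) ^ α * P t ∧
      |‖w t ξ‖ - √(P t)| ≤ A * √d := by
  have hα0 : 0 < α := by linarith
  obtain ⟨B, hB, hmol⟩ := exists_mollifier
  set S := ∫ x, ‖wx 1 x‖ ^ 2 with hS
  set M := ∫ x, ‖w 1 x‖ ^ 2 with hM
  have hS0 : 0 ≤ S := integral_nonneg fun x => by positivity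
  have hM0 : 0 ≤ M := integral_nonneg fun x => by positivity
  refine ⟨2 * (S + 1), c * B * (M + S + 1), by positivity, by positivity, fun ξ d hd => ?_⟩
  obtain ⟨φ, φ', hφ, hφ', hφ0, hφB, hφ'B, hφs, hφi, hφ1⟩ := hmol ξ d hd
  have cφ : Continuous φ := continuous_iff_continuousAt.2 fun x => (hφ x).continuousAt
  have hφA : ∀ x, |φ x| ≤ B * d⁻¹ := fun x => by rw [abs_of_nonneg (hφ0 x)]; exact hφB x
  refine ⟨fun t => ∫ x, ‖w t x‖ ^ 2 * φ x, deriv fun t => ∫ x, ‖w t x‖ ^ 2 * φ x,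
    fun t => ∫ x, ‖w t x‖ ^ α * ‖w t x‖ ^ 2 * φ x, fun t ht1 => ?_⟩
  have ht : 0 < t := by linarith
  have hSt : ∫ x, ‖wx t x‖ ^ 2 ≤ S :=
    h.antitoneOn_integral_norm_sq_wx hα hlam0 hlam (mem_Ioi.2 one_pos) ht ht1
  have hMt : ∫ x, ‖w t x‖ ^ 2 ≤ M :=
    h.antitoneOn_mass hα0 hc hlam0 (mem_Ioi.2 one_pos) ht ht1
  obtain ⟨P', hP, hPE⟩ := h.exists_hasDerivAt_local_mass hα0 hc ht hφ hφ' hφA hφ'B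
  have i2 : Integrable fun x => ‖w t x‖ ^ 2 * φ x :=
    (h.integrable_norm_sq ht).mul_bdd cφ.aestronglyMeasurable (Eventually.of_forall hφA)
  have i3 : Integrable fun x => ‖w t x‖ ^ α * (‖w t x‖ ^ 2 * φ x) := by
    simp only [← mul_assoc]
    exact (h.integrable_norm_rpow_mul_norm_sq hα0 ht).mul_bdd cφ.aestronglyMeasurable
      (Eventually.of_forall hφA)
  set o := (S + 1) * √d with ho
  have ho0 : 0 ≤ o := by positivity
  have hAo : 2 * (S + 1) * √d = 2 * o := by rw [ho]; ring
  have hosc : ∀ x, φ x ≠ 0 → |‖w t x‖ - ‖w t ξ‖| ≤ o := fun x hx => by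
    refine (abs_norm_sub_norm_le _ _).trans (h.norm_sub_le ht hSt hd ?_)
    by_contra hcon
    exact hx (hφs x (le_of_not_ge hcon))
  have hP0 : 0 ≤ ∫ x, ‖w t x‖ ^ 2 * φ x := integral_nonneg fun x => by
    have := hφ0 x
    positivity
  have hav := integral_mul_mem_Icc (f := fun x => ‖w t x‖ ^ 2) (g := fun _ => 1) (φ := φ)
    (a := (max (‖w t ξ‖ - o) 0) ^ 2) (b := (‖w t ξ‖ + o) ^ 2) (by simpa using hφi)
    (by simpa using i2) fun x => ⟨by simpa using hφ0 x, fun hx => by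
      have := abs_le.1 (hosc x (by simpa using hx))
      refine ⟨pow_le_pow_left₀ (le_max_right _ _) (max_le (by linarith) (norm_nonneg _)) 2,
        pow_le_pow_left₀ (norm_nonneg _) (by linarith) 2⟩⟩
  simp only [one_mul, hφ1, mul_one] at hav
  have hsq : |‖w t ξ‖ - √(∫ x, ‖w t x‖ ^ 2 * φ x)| ≤ o := by
    have h1 := Real.le_sqrt_of_sq_le hav.1
    have h2 := (Real.sqrt_le_left (by positivity)).2 hav.2
    rw [abs_le]
    constructor
    · linarith
    · linarith [le_max_left (‖w t ξ‖ - o) 0]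
  have hX := integral_mul_mem_Icc (f := fun x => ‖w t x‖ ^ α) (g := fun x => ‖w t x‖ ^ 2) (φ := φ)
    (a := (max (√(∫ x, ‖w t x‖ ^ 2 * φ x) - 2 * o) 0) ^ α)
    (b := (√(∫ x, ‖w t x‖ ^ 2 * φ x) + 2 * o) ^ α) i2 i3
    fun x => ⟨mul_nonneg (by positivity) (hφ0 x), fun hx => by
      have h1 := abs_le.1 (hosc x (right_ne_zero_of_mul hx))
      have h2 := abs_le.1 hsq
      exact ⟨Real.rpow_le_rpow (le_max_right _ _) (max_le (by linarith) (norm_nonneg _)) hα0.le,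
        Real.rpow_le_rpow (norm_nonneg _) (by linarith) hα0.le⟩⟩
  simp only [← mul_assoc] at hX
  rw [hAo]
  refine ⟨hP.differentiableAt.hasDerivAt, hP0, ?_, hX.1, hX.2, hsq.trans (by linarith)⟩
  rw [hP.deriv]
  refine hPE.trans ?_
  calc c * (t ^ 2)⁻¹ * (B * (d ^ 2)⁻¹) * ((∫ x, ‖w t x‖ ^ 2) + ∫ x, ‖wx t x‖ ^ 2)
      ≤ c * (t ^ 2)⁻¹ * (B * (d ^ 2)⁻¹) * (M + S + 1) :=
        mul_le_mul_of_nonneg_left (by linarith) (by positivity)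
    _ = _ := by ring

end ProfileSolution

lemma tendsto_rpow_atTop_nhds_zero {r : ℝ} (hr : r < 0) :
    Tendsto (fun t : ℝ => t ^ r) atTop (nhds 0) := by
  simpa using tendsto_rpow_neg_atTop (neg_pos.2 hr)

lemma tendsto_rpow_mul_barrier {α β b : ℝ} {G : ℝ → ℝ} (hα : 0 < α) (hβ : α * β = 1 - α / 2)
    (hb : 0 < b) (hG : Tendsto (fun t => G t / t ^ (1 - α / 2)) atTop (nhds b)) :
    Tendsto (fun t => t ^ (2 * β) * G t ^ (-(2 / α))) atTop (nhds (b ^ (-(2 / α)))) := by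
  have h1 := hG.rpow_const (p := -(2 / α)) (Or.inl hb.ne')
  refine h1.congr' ?_
  filter_upwards [hG.eventually_const_lt hb, eventually_gt_atTop 0] with t ht h0
  have ht' : 0 < G t := by
    have h2 := mul_pos ht (rpow_pos_of_pos h0 (1 - α / 2))
    rwa [div_mul_cancel₀ _ (rpow_pos_of_pos h0 _).ne'] at h2
  rw [Real.div_rpow ht'.le (by positivity), ← Real.rpow_mul h0.le, div_eq_mul_inv,
    ← Real.rpow_neg h0.le, mul_comm]
  congr 2
  rw [← hβ]
  field_simp

lemma tendsto_rpow_mul_sqrt_barrier {α β b : ℝ} {G : ℝ → ℝ} (hα : 0 < α)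
    (hβ : α * β = 1 - α / 2) (hb : 0 < b)
    (hG : Tendsto (fun t => G t / t ^ (1 - α / 2)) atTop (nhds b)) :
    Tendsto (fun t => t ^ β * √(G t ^ (-(2 / α)))) atTop (nhds √(b ^ (-(2 / α)))) := by
  refine ((tendsto_rpow_mul_barrier hα hβ hb hG).sqrt).congr' ?_
  filter_upwards [eventually_gt_atTop 0] with t h0
  rw [Real.sqrt_mul (by positivity), Real.sqrt_eq_rpow (t ^ (2 * β)), ← Real.rpow_mul h0.le]
  congr 2
  ring

lemma sqrt_rpow_neg_eighth {t : ℝ} (ht : 0 < t) :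
    √(t ^ (-(1 / 8) : ℝ)) = t ^ (-(1 / 16) : ℝ) := by
  rw [Real.sqrt_eq_rpow, ← Real.rpow_mul ht.le]
  norm_num

/-- The oscillation at scale `t^{-1/8}` is negligible compared with the barrier. -/
lemma eventually_oscillation_le {α β b A δ : ℝ} {G : ℝ → ℝ} (hα : 0 < α)
    (hβ : α * β = 1 - α / 2) (hβ2 : β < 1 / 16) (hb : 0 < b) (hδ : 0 < δ)
    (hG : Tendsto (fun t => G t / t ^ (1 - α / 2)) atTop (nhds b)) :
    ∀ᶠ t in atTop, A * √(t ^ (-(1 / 8) : ℝ)) ≤ δ * √(G t ^ (-(2 / α))) := by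
  have h1 := (tendsto_rpow_mul_sqrt_barrier hα hβ hb hG).const_mul δ
  have h2 := (tendsto_rpow_atTop_nhds_zero (r := β - 1 / 16) (by linarith)).const_mul A
  rw [mul_zero] at h2
  have hpos : 0 < δ * √(b ^ (-(2 / α))) := by positivity
  filter_upwards [h2.eventually_lt h1 hpos, eventually_gt_atTop 0] with t ht h0
  have e : A * t ^ (β - 1 / 16) = t ^ β * (A * √(t ^ (-(1 / 8) : ℝ))) := by
    rw [sqrt_rpow_neg_eighth h0, sub_eq_add_neg, Real.rpow_add h0]; ring
  rw [e, mul_left_comm δ] at ht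
  exact (lt_of_mul_lt_mul_left ht (by positivity)).le

/-- The flux error on `[t^{3/4}, t]` is negligible compared with the dissipation. -/
lemma eventually_flux_lt {α β b E L δ : ℝ} {G : ℝ → ℝ} (hα : 0 < α)
    (hβ : α * β = 1 - α / 2) (hβ2 : β < 1 / 16) (hb : 0 < b) (hδ : 0 < δ) (hL : 0 < L)
    (hG : Tendsto (fun t => G t / t ^ (1 - α / 2)) atTop (nhds b)) :
    ∀ᶠ t in atTop, E * ((t ^ (3 / 4 : ℝ)) ^ 2)⁻¹ * ((t ^ (-(1 / 8) : ℝ)) ^ 2)⁻¹ <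
      2 * L * δ * t ^ (-(α / 2)) * (G t ^ (-(2 / α))) ^ (1 + α / 2) := by
  have hpos : 0 < b ^ (-(2 / α)) := by positivity
  have h0 := tendsto_rpow_mul_barrier hα hβ hb hG
  have h1 := (h0.rpow_const (p := 1 + α / 2) (Or.inl hpos.ne')).const_mul (2 * L * δ)
  have h2 := (tendsto_rpow_atTop_nhds_zero (r := 2 * β - 1 / 4) (by linarith)).const_mul E
  rw [mul_zero] at h2
  filter_upwards [h2.eventually_lt h1 (by positivity), eventually_gt_atTop 0,
    h0.eventually_const_lt hpos] with t ht h0 hm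
  have hm' : 0 ≤ G t ^ (-(2 / α)) := (pos_of_mul_pos_right hm (by positivity)).le
  have e1 : E * t ^ (2 * β - 1 / 4) = t ^ (1 + 2 * β) *
      (E * ((t ^ (3 / 4 : ℝ)) ^ 2)⁻¹ * ((t ^ (-(1 / 8) : ℝ)) ^ 2)⁻¹) := by
    rw [← Real.rpow_natCast, ← Real.rpow_natCast, ← Real.rpow_mul h0.le, ← Real.rpow_mul h0.le,
      ← Real.rpow_neg h0.le, ← Real.rpow_neg h0.le]
    have : 2 * β - 1 / 4 = 1 + 2 * β + -(3 / 4 * ((2 : ℕ) : ℝ)) + -(-(1 / 8) * ((2 : ℕ) : ℝ)) := by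
      push_cast; ring
    rw [this, Real.rpow_add h0, Real.rpow_add h0]
    ring
  have e2 : 2 * L * δ * (t ^ (2 * β) * G t ^ (-(2 / α))) ^ (1 + α / 2) = t ^ (1 + 2 * β) *
      (2 * L * δ * t ^ (-(α / 2)) * (G t ^ (-(2 / α))) ^ (1 + α / 2)) := by
    rw [Real.mul_rpow (by positivity) hm', ← Real.rpow_mul h0.le]
    have : 2 * β * (1 + α / 2) = 1 + 2 * β + -(α / 2) := by linear_combination hβ
    rw [this, Real.rpow_add h0]
    ring
  rw [e1, e2] at ht
  exact lt_of_mul_lt_mul_left ht (by positivity)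

/-- Lower order terms do not affect the leading coefficient. -/
lemma tendsto_add_mul_rpow_div {b γ : ℝ} {q : ℝ → ℝ}
    (hq : Tendsto (fun t => q t / t ^ γ) atTop (nhds 0)) :
    Tendsto (fun t => (q t + b * t ^ γ) / t ^ γ) atTop (nhds b) := by
  have := hq.add_const b
  rw [zero_add] at this
  refine this.congr' ?_
  filter_upwards [eventually_gt_atTop 0] with t h0
  have : t ^ γ ≠ 0 := (rpow_pos_of_pos h0 γ).ne'
  field_simp

lemma tendsto_const_mul_rpow_div {C r γ : ℝ} (h : r < γ) :
    Tendsto (fun t : ℝ => C * t ^ r / t ^ γ) atTop (nhds 0) := by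
  have := (tendsto_rpow_atTop_nhds_zero (r := r - γ) (by linarith)).const_mul C
  rw [mul_zero] at this
  refine this.congr' ?_
  filter_upwards [eventually_gt_atTop 0] with t h0
  rw [Real.rpow_sub h0, mul_div_assoc]

lemma rpow_three_quarters_lt {t : ℝ} (ht : 1 < t) : t ^ (3 / 4 : ℝ) < t := by
  simpa using Real.rpow_lt_rpow_of_exponent_lt ht (by norm_num : (3 / 4 : ℝ) < 1)

namespace ProfileSolution

variable {c α : ℝ} {lam : ℂ} {w wt wx wxx : ℝ → ℝ → ℂ}

/-- Sharp upper bound for the profile. -/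
lemma eventually_norm_le (h : ProfileSolution c α lam w wt wx wxx) (hα : 1 < α) (hα2 : α < 2)
    (hc : 0 < c) (hlam0 : 0 < lam.im)
    (hlam : α * |lam.re| / (2 * Real.sqrt (α + 1)) ≤ lam.im) {β ε : ℝ}
    (hβ : α * β = 1 - α / 2) (hβ2 : β < 1 / 16) (hε : 0 < ε) :
    ∀ᶠ t in atTop, ∀ ξ, t ^ β * ‖w t ξ‖ ≤
      √((α * lam.im / (1 - α / 2)) ^ (-(2 / α))) + ε := by
  have hα0 : 0 < α := by linarith
  have hγ : 0 < 1 - α / 2 := by linarith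
  obtain ⟨A, E, hA, hE, hloc⟩ := h.exists_local_average hα hc hlam0 hlam
  set k := α * lam.im / (1 - α / 2) with hk
  have hk0 : 0 < k := by positivity
  have hcont : ContinuousAt (fun δ : ℝ => k * ((1 - δ) ^ α - δ)) 0 :=
    continuousAt_const.mul (((continuousAt_const.sub continuousAt_id).rpow_const
      (Or.inr hα0.le)).sub continuousAt_id)
  have hval : k * ((1 - (0 : ℝ)) ^ α - 0) = k := by simp
  have hcont2 : ContinuousAt (fun δ : ℝ => √((k * ((1 - δ) ^ α - δ)) ^ (-(2 / α)))) 0 :=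
    (hcont.rpow_const (Or.inl (by simpa using hk0.ne'))).sqrt
  have e1 : ∀ᶠ δ in nhds (0 : ℝ), 0 < k * ((1 - δ) ^ α - δ) :=
    hcont.eventually_const_lt (by simpa using hk0)
  have e2 : ∀ᶠ δ in nhds (0 : ℝ), √((k * ((1 - δ) ^ α - δ)) ^ (-(2 / α))) <
      √(k ^ (-(2 / α))) + ε / 2 :=
    hcont2.eventually_lt_const (by simp only [hval]; linarith)
  obtain ⟨δ, ⟨⟨hδb, hδε⟩, hδ1⟩, hδ0⟩ := ((((e1.and e2).and
    (eventually_lt_nhds one_pos)).filter_mono nhdsWithin_le_nhds).and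
      (self_mem_nhdsWithin : Ioi (0 : ℝ) ∈ nhdsWithin 0 (Ioi 0))).exists
  set b := k * ((1 - δ) ^ α - δ) with hb
  have hbL : 2 / α * b * (1 - α / 2) = 2 * lam.im * ((1 - δ) ^ α - δ) := by
    have h2 : 2 - α ≠ 0 := by linarith
    rw [hb, hk]; field_simp
  have hG : Tendsto (fun t : ℝ => (1 + b * t ^ (1 - α / 2)) / t ^ (1 - α / 2)) atTop (nhds b) :=
    tendsto_add_mul_rpow_div (by simpa using tendsto_const_mul_rpow_div (C := 1) hγ)
  have hG2 : Tendsto (fun t : ℝ => b * (t ^ (1 - α / 2) - (t ^ (3 / 4 : ℝ)) ^ (1 - α / 2)) /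
      t ^ (1 - α / 2)) atTop (nhds b) := by
    refine (tendsto_add_mul_rpow_div (b := b) (tendsto_const_mul_rpow_div (C := -b)
      (r := 3 / 4 * (1 - α / 2)) (γ := 1 - α / 2) (by linarith))).congr' ?_
    filter_upwards [eventually_gt_atTop 0] with t h0
    rw [← Real.rpow_mul h0.le]
    ring
  have hlim := (tendsto_rpow_mul_sqrt_barrier hα0 hβ hδb hG2).add
    ((tendsto_rpow_atTop_nhds_zero (r := β - 1 / 16) (by linarith)).const_mul A)
  rw [mul_zero, add_zero] at hlim
  filter_upwards [eventually_oscillation_le (A := A) hα0 hβ hβ2 hδb hδ0 hG,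
    eventually_flux_lt (E := E) hα0 hβ hβ2 hδb hδ0 hlam0 hG,
    hlim.eventually_lt_const hδε, eventually_gt_atTop 1] with t ho hf hle ht1 ξ
  have h0 : 0 < t := by linarith
  obtain ⟨P, P', X, hP⟩ := hloc ξ (t ^ (-(1 / 8) : ℝ)) (by positivity)
  have hT1 : 1 ≤ t ^ (3 / 4 : ℝ) := Real.one_le_rpow ht1.le (by norm_num)
  have hmain := le_barrier_of_perturbed_ode (P := P) (P' := P') (X := X) hα0 hα2 hlam0 hδ0 hδ1
    (by linarith : 0 < t ^ (3 / 4 : ℝ)) (rpow_three_quarters_lt ht1) hδb hbL ho hf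
    (fun s hs => (hP s (hT1.trans hs.1)).1)
    (fun s hs => (hP s (hT1.trans hs.1)).2.2.1.trans (by gcongr; exact hs.1))
    (fun s hs => (hP s (hT1.trans hs.1)).2.2.2.1)
  have hw := (abs_le.1 (hP t ht1.le).2.2.2.2.2).2
  have hs := Real.sqrt_le_sqrt hmain
  rw [sqrt_rpow_neg_eighth h0] at hw
  have e3 : t ^ (β - 1 / 16) = t ^ β * t ^ (-(1 / 16) : ℝ) := by
    rw [sub_eq_add_neg, Real.rpow_add h0]
  rw [e3] at hle
  calc t ^ β * ‖w t ξ‖ ≤ t ^ β * (√((b * (t ^ (1 - α / 2) -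
        (t ^ (3 / 4 : ℝ)) ^ (1 - α / 2))) ^ (-(2 / α))) + A * t ^ (-(1 / 16) : ℝ)) := by
        gcongr; linarith
    _ ≤ _ := by linarith

/-- Sharp lower bound for the profile, starting from a rough one. -/
lemma eventually_le_norm_of_rough (h : ProfileSolution c α lam w wt wx wxx) (hα : 1 < α)
    (hα2 : α < 2) (hc : 0 < c) (hlam0 : 0 < lam.im)
    (hlam : α * |lam.re| / (2 * Real.sqrt (α + 1)) ≤ lam.im) {β ε r : ℝ}
    (hβ : α * β = 1 - α / 2) (hβ2 : β < 1 / 16) (hε : 0 < ε) (hr : 0 < r)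
    (hrough : ∀ᶠ t in atTop, ∃ ξ, r * t ^ (-(5 / 4 * β)) ≤ ‖w t ξ‖) :
    ∀ᶠ t in atTop, ∃ ξ, √((α * lam.im / (1 - α / 2)) ^ (-(2 / α))) - ε ≤ t ^ β * ‖w t ξ‖ := by
  have hα0 : 0 < α := by linarith
  have hγ : 0 < 1 - α / 2 := by linarith
  have hβ0 : 0 < β := by
    by_contra hcon
    nlinarith
  obtain ⟨A, E, hA, hE, hloc⟩ := h.exists_local_average hα hc hlam0 hlam
  set k := α * lam.im / (1 - α / 2) with hk
  have hk0 : 0 < k := by positivity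
  have hcont : ContinuousAt (fun δ : ℝ => k * ((1 + δ) ^ α + δ)) 0 :=
    continuousAt_const.mul (((continuousAt_const.add continuousAt_id).rpow_const
      (Or.inr hα0.le)).add continuousAt_id)
  have hval : k * ((1 + (0 : ℝ)) ^ α + 0) = k := by simp
  have hcont2 : ContinuousAt (fun δ : ℝ => √((k * ((1 + δ) ^ α + δ)) ^ (-(2 / α)))) 0 :=
    (hcont.rpow_const (Or.inl (by simpa using hk0.ne'))).sqrt
  have e2 : ∀ᶠ δ in nhds (0 : ℝ), √(k ^ (-(2 / α))) - ε / 2 <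
      √((k * ((1 + δ) ^ α + δ)) ^ (-(2 / α))) :=
    hcont2.eventually_const_lt (by simp only [hval]; linarith)
  obtain ⟨δ, hδε, hδ0 : 0 < δ⟩ := ((e2.filter_mono nhdsWithin_le_nhds).and
      (self_mem_nhdsWithin : Ioi (0 : ℝ) ∈ nhdsWithin 0 (Ioi 0))).exists
  set b := k * ((1 + δ) ^ α + δ) with hb
  have hδb : 0 < b := by positivity
  have hbL : 2 / α * b * (1 - α / 2) = 2 * lam.im * ((1 + δ) ^ α + δ) := by
    have h2 : 2 - α ≠ 0 := by linarith
    rw [hb, hk]; field_simp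
  set q : ℝ → ℝ := fun t => ((r / 2) ^ 2) ^ (-(α / 2)) * t ^ (15 / 16 * (1 - α / 2)) with hq
  have hG : Tendsto (fun t : ℝ => (q t + b * t ^ (1 - α / 2)) / t ^ (1 - α / 2)) atTop (nhds b) :=
    tendsto_add_mul_rpow_div (tendsto_const_mul_rpow_div (by linarith))
  have hlim := (tendsto_rpow_mul_sqrt_barrier hα0 hβ hδb hG).sub
    ((tendsto_rpow_atTop_nhds_zero (r := β - 1 / 16) (by linarith)).const_mul A)
  rw [mul_zero, sub_zero] at hlim
  have hsmall := (tendsto_rpow_atTop_nhds_zero (r := 15 / 16 * β - 1 / 16)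
    (by linarith)).const_mul A
  rw [mul_zero] at hsmall
  filter_upwards [eventually_oscillation_le (A := A) hα0 hβ hβ2 hδb hδ0 hG,
    eventually_flux_lt (E := E) hα0 hβ hβ2 hδb hδ0 hlam0 hG,
    hlim.eventually_const_lt hδε, eventually_gt_atTop 1,
    (tendsto_rpow_atTop (by norm_num : (0 : ℝ) < 3 / 4)).eventually hrough,
    hsmall.eventually_lt_const (half_pos hr)] with t ho hf hle ht1 hξ hsm
  obtain ⟨ξ, hξ⟩ := hξ
  have h0 : 0 < t := by linarith
  obtain ⟨P, P', X, hP⟩ := hloc ξ (t ^ (-(1 / 8) : ℝ)) (by positivity)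
  have hT1 : 1 ≤ t ^ (3 / 4 : ℝ) := Real.one_le_rpow ht1.le (by norm_num)
  have hPT : q t ^ (-(2 / α)) ≤ P (t ^ (3 / 4 : ℝ)) := by
    have h1 := (abs_le.1 (hP _ hT1).2.2.2.2.2).2
    rw [sqrt_rpow_neg_eighth h0] at h1
    rw [← Real.rpow_mul h0.le] at hξ
    have e3 : A * t ^ (15 / 16 * β - 1 / 16) =
        A * t ^ (-(1 / 16) : ℝ) * t ^ (15 / 16 * β) := by
      rw [sub_eq_add_neg, Real.rpow_add h0]; ring
    rw [e3] at hsm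
    have h3 : A * t ^ (-(1 / 16) : ℝ) ≤ r / 2 * t ^ (3 / 4 * -(5 / 4 * β)) := by
      have : 3 / 4 * -(5 / 4 * β) = -(15 / 16 * β) := by ring
      rw [this, Real.rpow_neg h0.le (15 / 16 * β), ← div_eq_mul_inv, le_div_iff₀ (by positivity)]
      exact hsm.le
    have h4 : r / 2 * t ^ (3 / 4 * -(5 / 4 * β)) ≤ √(P (t ^ (3 / 4 : ℝ))) := by linarith
    have h5 := (Real.le_sqrt (by positivity) (hP _ hT1).2.1).1 h4
    refine le_trans (le_of_eq ?_) h5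
    rw [hq]
    simp only
    rw [Real.mul_rpow (by positivity) (by positivity), ← Real.rpow_mul (by positivity),
      ← Real.rpow_mul h0.le, mul_pow, ← Real.rpow_natCast (t ^ _), ← Real.rpow_mul h0.le]
    have e4 : -(α / 2) * -(2 / α) = 1 := by field_simp
    have e5 : 15 / 16 * (1 - α / 2) * -(2 / α) = 3 / 4 * -(5 / 4 * β) * ((2 : ℕ) : ℝ) := by
      rw [← hβ]; push_cast; field_simp; ring
    rw [e4, e5, Real.rpow_one]
  have hmain := barrier_le_of_perturbed_ode (P := P) (P' := P') (X := X) hα0 hα2 hlam0 hδ0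
    (by linarith : 0 < t ^ (3 / 4 : ℝ)) (rpow_three_quarters_lt ht1) hδb hbL
    (by positivity) (by positivity) ho hf
    (fun s hs => (hP s (hT1.trans hs.1)).1)
    (fun s hs => (hP s (hT1.trans hs.1)).2.2.1.trans (by gcongr; exact hs.1))
    (fun s hs => (hP s (hT1.trans hs.1)).2.2.2.2.1) hPT
  have hw := (abs_le.1 (hP t ht1.le).2.2.2.2.2).1
  have hs := Real.sqrt_le_sqrt hmain
  rw [sqrt_rpow_neg_eighth h0] at hw
  have e3 : t ^ (β - 1 / 16) = t ^ β * t ^ (-(1 / 16) : ℝ) := by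
    rw [sub_eq_add_neg, Real.rpow_add h0]
  rw [e3] at hle
  have hfin : t ^ β * (√((q t + b * t ^ (1 - α / 2)) ^ (-(2 / α))) - A * t ^ (-(1 / 16) : ℝ)) ≤
      t ^ β * ‖w t ξ‖ := by gcongr; linarith
  exact ⟨ξ, by linarith⟩

end ProfileSolution

/-- A differential inequality `P' ≥ -(s/t) P - E t⁻²` prevents decay faster than `t^{-s}`. -/
lemma le_mul_rpow_of_deriv_ge {P P' : ℝ → ℝ} {s E a t : ℝ} (hs : s < 1) (ha : 0 < a)
    (hE : 0 ≤ E) (hat : a ≤ t) (hP : ∀ τ, a ≤ τ → HasDerivAt P (P' τ) τ)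
    (hP' : ∀ τ, a ≤ τ → -(s / τ) * P τ - E * (τ ^ 2)⁻¹ ≤ P' τ) :
    P a * a ^ s - E / (1 - s) * a ^ (s - 1) ≤ P t * t ^ s := by
  have hd : ∀ τ, a ≤ τ → HasDerivAt (fun τ => P τ * τ ^ s - E / (1 - s) * τ ^ (s - 1))
      ((P' τ * τ ^ s + P τ * (s * τ ^ (s - 1))) -
        E / (1 - s) * ((s - 1) * τ ^ (s - 1 - 1))) τ := fun τ hτ => by
    have h0 : τ ≠ 0 := (ha.trans_le hτ).ne'
    exact ((hP τ hτ).mul (Real.hasDerivAt_rpow_const (Or.inl h0))).sub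
      ((Real.hasDerivAt_rpow_const (Or.inl h0)).const_mul _)
  have hmono : MonotoneOn (fun τ => P τ * τ ^ s - E / (1 - s) * τ ^ (s - 1)) (Ici a) := by
    refine monotoneOn_of_hasDerivWithinAt_nonneg (convex_Ici a)
      (fun τ hτ => (hd τ hτ).continuousAt.continuousWithinAt)
      (fun τ hτ => (hd τ (interior_subset hτ)).hasDerivWithinAt) fun τ hτ => ?_
    replace hτ : a ≤ τ := interior_subset hτ
    have h0 : 0 < τ := ha.trans_le hτ
    have e1 : τ ^ (s - 1) = τ ^ s / τ := by rw [Real.rpow_sub h0, Real.rpow_one]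
    have e2 : τ ^ (s - 1 - 1) = τ ^ s * (τ ^ 2)⁻¹ := by
      rw [Real.rpow_sub h0, Real.rpow_sub h0, Real.rpow_one]; field_simp
    have e3 : E / (1 - s) * ((s - 1) * τ ^ (s - 1 - 1)) = -(E * (τ ^ s * (τ ^ 2)⁻¹)) := by
      have : 1 - s ≠ 0 := by linarith
      rw [e2]; field_simp; ring
    rw [e3, e1]
    have h1 := mul_le_mul_of_nonneg_right (hP' τ hτ) (rpow_pos_of_pos h0 s).le
    have e4 : P τ * (s * (τ ^ s / τ)) = s / τ * P τ * τ ^ s := by ring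
    rw [e4]
    linarith
  have h1 := hmono self_mem_Ici hat hat
  have h2 : 0 ≤ E / (1 - s) * t ^ (s - 1) := by
    have : 0 < 1 - s := by linarith
    have := ha.trans_le hat
    positivity
  simp only at h1
  linarith

/-- Pigeonhole for weighted averages. -/
lemma exists_lt_norm_sq_of_lt_integral {f : ℝ → ℂ} {φ : ℝ → ℝ} {R v : ℝ} (hR : 0 ≤ R)
    (hf : Integrable fun x => ‖f x‖ ^ 2 * φ x) (h1 : ∀ x, φ x ≤ 1)
    (hs : ∀ x, R ≤ |x| → φ x = 0) (hv : 2 * R * v < ∫ x, ‖f x‖ ^ 2 * φ x) :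
    ∃ x, v < ‖f x‖ ^ 2 := by
  by_contra! hcon
  refine hv.not_ge ?_
  have hi : Integrable ((Icc (-R) R).indicator fun _ => v) :=
    (integrable_indicator_iff measurableSet_Icc).2 (by simp)
  refine (integral_mono hf hi fun x => ?_).trans ?_
  · by_cases hx : x ∈ Icc (-R) R
    · rw [indicator_of_mem hx]
      exact (mul_le_of_le_one_right (by positivity) (h1 x)).trans (hcon x)
    · rw [indicator_of_notMem hx]
      have : R ≤ |x| := by
        by_contra hlt
        exact hx (abs_le.1 (le_of_not_ge hlt))
      simp [hs x this]
  · rw [integral_indicator measurableSet_Icc, setIntegral_const]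
    simp only [Measure.real, Real.volume_Icc, smul_eq_mul]
    rw [ENNReal.toReal_ofReal (by linarith)]
    exact le_of_eq (by ring)

namespace ProfileSolution

variable {c α : ℝ} {lam : ℂ} {w wt wx wxx : ℝ → ℝ → ℂ}

/-- The upper bound controls the dissipation rate by `1/t`. -/
lemma eventually_rate_le (h : ProfileSolution c α lam w wt wx wxx) (hα : 1 < α) (hα2 : α < 2)
    (hc : 0 < c) (hlam0 : 0 < lam.im)
    (hlam : α * |lam.re| / (2 * Real.sqrt (α + 1)) ≤ lam.im) {β : ℝ}
    (hβ : α * β = 1 - α / 2) (hβ2 : β < 1 / 16) :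
    ∀ᶠ t in atTop, ∀ x, 2 * lam.im * t ^ (-(α / 2)) * ‖w t x‖ ^ α ≤ 5 / 2 * β / t := by
  have hα0 : 0 < α := by linarith
  have hγ : 0 < 1 - α / 2 := by linarith
  have hβ0 : 0 < β := by
    by_contra hcon
    nlinarith
  set k := α * lam.im / (1 - α / 2) with hk
  have hk0 : 0 < k := by positivity
  set K := √(k ^ (-(2 / α))) with hK
  have hK0 : 0 < K := by positivity
  have hKα : 2 * lam.im * K ^ α = 2 * β := by
    rw [hK, Real.sqrt_eq_rpow, ← Real.rpow_mul hk0.le, ← Real.rpow_mul hk0.le]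
    have e1 : -(2 / α) * (1 / 2) * α = -1 := by field_simp
    rw [e1, Real.rpow_neg_one, hk, ← hβ]
    field_simp
  have hcont : ContinuousAt (fun ε : ℝ => 2 * lam.im * (K + ε) ^ α) 0 :=
    continuousAt_const.mul ((continuousAt_const.add continuousAt_id).rpow_const (Or.inr hα0.le))
  have e2 : ∀ᶠ ε in nhds (0 : ℝ), 2 * lam.im * (K + ε) ^ α < 5 / 2 * β :=
    hcont.eventually_lt_const (by simp only [add_zero, hKα]; linarith)
  obtain ⟨ε, hε, hε0 : 0 < ε⟩ := ((e2.filter_mono nhdsWithin_le_nhds).and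
      (self_mem_nhdsWithin : Ioi (0 : ℝ) ∈ nhdsWithin 0 (Ioi 0))).exists
  filter_upwards [h.eventually_norm_le hα hα2 hc hlam0 hlam hβ hβ2 hε0,
    eventually_gt_atTop 0] with t ht h0 x
  have h1 := Real.rpow_le_rpow (by positivity) (ht x) hα0.le
  rw [Real.mul_rpow (by positivity) (by positivity), ← Real.rpow_mul h0.le, mul_comm β, hβ,
    sub_eq_add_neg, Real.rpow_add h0, Real.rpow_one] at h1
  rw [le_div_iff₀ h0]
  calc 2 * lam.im * t ^ (-(α / 2)) * ‖w t x‖ ^ α * t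
      = 2 * lam.im * (t * t ^ (-(α / 2)) * ‖w t x‖ ^ α) := by ring
    _ ≤ 2 * lam.im * (K + ε) ^ α := mul_le_mul_of_nonneg_left h1 (by positivity)
    _ ≤ _ := hε.le

/-- Rough lower bound: a nontrivial profile does not decay faster than `t^{-5β/4}`. -/
lemma exists_rough_lower_bound (h : ProfileSolution c α lam w wt wx wxx) (hα : 1 < α)
    (hα2 : α < 2) (hc : 0 < c) (hlam0 : 0 < lam.im)
    (hlam : α * |lam.re| / (2 * Real.sqrt (α + 1)) ≤ lam.im) {β : ℝ}
    (hβ : α * β = 1 - α / 2) (hβ2 : β < 1 / 16) (hne : ∀ t, 0 < t → ∃ x, w t x ≠ 0) :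
    ∃ r, 0 < r ∧ ∀ᶠ t in atTop, ∃ ξ, r * t ^ (-(5 / 4 * β)) ≤ ‖w t ξ‖ := by
  have hα0 : 0 < α := by linarith
  obtain ⟨t₀, ht₀⟩ := eventually_atTop.1 ((h.eventually_rate_le hα hα2 hc hlam0 hlam hβ hβ2).and
    (eventually_ge_atTop 1))
  have ht₀1 : 1 ≤ t₀ := (ht₀ t₀ le_rfl).2
  set s := 5 / 2 * β with hs
  have hs1 : s < 1 := by rw [hs]; linarith
  obtain ⟨B, hB, hcut⟩ := exists_cutoff
  set S := ∫ x, ‖wx 1 x‖ ^ 2 with hS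
  set M := ∫ x, ‖w 1 x‖ ^ 2 with hM
  have hS0 : 0 ≤ S := integral_nonneg fun x => by positivity
  have hM0 : 0 ≤ M := integral_nonneg fun x => by positivity
  have hdom : ∀ (φ : ℝ → ℝ) (_ : Continuous φ) (_ : ∀ x, 0 ≤ φ x) (_ : ∀ x, φ x ≤ 1) (t : ℝ),
      t₀ ≤ t → 2 * lam.im * t ^ (-(α / 2)) * (∫ x, ‖w t x‖ ^ α * ‖w t x‖ ^ 2 * φ x) ≤
        s / t * ∫ x, ‖w t x‖ ^ 2 * φ x := by
    intro φ cφ h0 h1 t ht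
    have htpos : 0 < t := by linarith
    have hφA : ∀ x, ‖φ x‖ ≤ 1 := fun x => by rw [Real.norm_of_nonneg (h0 x)]; exact h1 x
    rw [← integral_const_mul, ← integral_const_mul]
    refine integral_mono (((h.integrable_norm_rpow_mul_norm_sq hα0 htpos).mul_bdd
      cφ.aestronglyMeasurable (Eventually.of_forall hφA)).const_mul _)
      (((h.integrable_norm_sq htpos).mul_bdd cφ.aestronglyMeasurable
        (Eventually.of_forall hφA)).const_mul _) fun x => ?_
    have h2 := mul_le_mul_of_nonneg_right ((ht₀ t ht).1 x)
      (mul_nonneg (sq_nonneg ‖w t x‖) (h0 x))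
    calc 2 * lam.im * t ^ (-(α / 2)) * (‖w t x‖ ^ α * ‖w t x‖ ^ 2 * φ x)
        = 2 * lam.im * t ^ (-(α / 2)) * ‖w t x‖ ^ α * (‖w t x‖ ^ 2 * φ x) := by ring
      _ ≤ _ := h2
  set μ := (∫ x, ‖w t₀ x‖ ^ 2) * t₀ ^ s with hμ
  have hμ0 : 0 < μ := by
    obtain ⟨x, hx⟩ := hne t₀ (by linarith)
    have : 0 < ∫ x, ‖w t₀ x‖ ^ 2 := by
      refine integral_pos_of_integrable_nonneg_nonzero (x := x)
        ((h.continuous_space (by linarith)).norm.pow 2) (h.integrable_norm_sq (by linarith))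
        (fun x => by positivity) ?_
      simpa using hx
    positivity
  have hmass : ∀ t, t₀ ≤ t → μ ≤ (∫ x, ‖w t x‖ ^ 2) * t ^ s := fun t ht => by
    have := le_mul_rpow_of_deriv_ge (E := 0) hs1 (by linarith : 0 < t₀) le_rfl ht
      (fun τ hτ => h.hasDerivAt_mass hα0 hc (by linarith)) fun τ hτ => by
        have := hdom (fun _ => 1) continuous_const (fun _ => zero_le_one) (fun _ => le_rfl) τ hτ
        simp only [mul_one] at this
        linarith
    simpa using this
  set E := c * B * (M + S) with hE
  have hE0 : 0 ≤ E := by positivity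
  have hlim := (tendsto_rpow_atTop_nhds_zero (r := s - 1) (by linarith)).const_mul (E / (1 - s))
  rw [mul_zero] at hlim
  obtain ⟨T, hT, hTt⟩ := ((hlim.eventually_lt_const (by positivity : 0 < μ / 4)).and
    (eventually_ge_atTop t₀)).exists
  have hT0 : 0 < T := by linarith
  have hMT : 0 < ∫ x, ‖w T x‖ ^ 2 :=
    pos_of_mul_pos_left (hμ0.trans_le (hmass T hTt)) (by positivity)
  obtain ⟨R, hRM, hR⟩ := (((intervalIntegral_tendsto_integral (h.integrable_norm_sq hT0)
    tendsto_neg_atTop_atBot tendsto_id).eventually_const_lt (half_lt_self hMT)).and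
      (eventually_ge_atTop 1)).exists
  obtain ⟨φ, φ', hφ, hφ', hφ0, hφ1, hφB, hone, hzero⟩ := hcut R hR
  have cφ : Continuous φ := continuous_iff_continuousAt.2 fun x => (hφ x).continuousAt
  have hφA : ∀ x, |φ x| ≤ 1 := fun x => by rw [abs_of_nonneg (hφ0 x)]; exact hφ1 x
  have hfint : ∀ t, 0 < t → Integrable fun x => ‖w t x‖ ^ 2 * φ x := fun t ht =>
    (h.integrable_norm_sq ht).mul_bdd cφ.aestronglyMeasurable (Eventually.of_forall hφA)
  have hPT : (∫ x, ‖w T x‖ ^ 2) / 2 ≤ ∫ x, ‖w T x‖ ^ 2 * φ x := by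
    refine hRM.le.trans ?_
    rw [id_eq, intervalIntegral.integral_of_le (by linarith)]
    refine le_trans (le_of_eq ?_) (setIntegral_le_integral (s := Ioc (-R) R) (hfint T hT0)
      (Eventually.of_forall fun x => mul_nonneg (sq_nonneg _) (hφ0 x)))
    refine setIntegral_congr_fun measurableSet_Ioc fun x hx => ?_
    rw [hone x (abs_le.2 ⟨hx.1.le, hx.2⟩), mul_one]
  have hmain : ∀ t, T ≤ t → μ / 4 ≤ (∫ x, ‖w t x‖ ^ 2 * φ x) * t ^ s := fun t ht => by
    have h1 := le_mul_rpow_of_deriv_ge (P := fun t => ∫ x, ‖w t x‖ ^ 2 * φ x)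
      (P' := deriv fun t => ∫ x, ‖w t x‖ ^ 2 * φ x) hs1 hT0 hE0 ht
      (fun τ hτ => by
        obtain ⟨P', hP, -⟩ := h.exists_hasDerivAt_local_mass hα0 hc (by linarith : 0 < τ)
          hφ hφ' hφA hφB
        exact hP.differentiableAt.hasDerivAt)
      (fun τ hτ => by
        have hτ0 : 0 < τ := by linarith
        obtain ⟨P', hP, hb⟩ := h.exists_hasDerivAt_local_mass hα0 hc hτ0 hφ hφ' hφA hφB
        have hSt : ∫ x, ‖wx τ x‖ ^ 2 ≤ S :=
          h.antitoneOn_integral_norm_sq_wx hα hlam0 hlam (mem_Ioi.2 one_pos) hτ0 (by linarith)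
        have hMt : ∫ x, ‖w τ x‖ ^ 2 ≤ M :=
          h.antitoneOn_mass hα0 hc hlam0 (mem_Ioi.2 one_pos) hτ0 (by linarith)
        have h1 : c * (τ ^ 2)⁻¹ * B * ((∫ x, ‖w τ x‖ ^ 2) + ∫ x, ‖wx τ x‖ ^ 2) ≤
            E * (τ ^ 2)⁻¹ :=
          calc _ ≤ c * (τ ^ 2)⁻¹ * B * (M + S) :=
                mul_le_mul_of_nonneg_left (by linarith) (by positivity)
            _ = _ := by rw [hE]; ring
        have h2 := (abs_le.1 hb).1
        have h3 := hdom φ cφ hφ0 hφ1 τ (hTt.trans hτ)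
        rw [hP.deriv]
        linarith)
    have h2 := mul_le_mul_of_nonneg_right hPT (rpow_pos_of_pos hT0 s).le
    have h3 := hmass T hTt
    linarith
  refine ⟨√(μ / (32 * R)), by positivity, ?_⟩
  filter_upwards [eventually_ge_atTop T] with t ht
  have ht0 : 0 < t := by linarith
  have hv : 2 * (2 * R) * (μ / (32 * R) * t ^ (-s)) < ∫ x, ‖w t x‖ ^ 2 * φ x := by
    have h1 : μ / 4 * t ^ (-s) ≤ ∫ x, ‖w t x‖ ^ 2 * φ x := by
      rw [Real.rpow_neg ht0.le, ← div_eq_mul_inv, div_le_iff₀ (by positivity)]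
      exact hmain t ht
    have h2 : 2 * (2 * R) * (μ / (32 * R) * t ^ (-s)) = μ / 8 * t ^ (-s) := by
      field_simp; ring
    have h3 : 0 < μ / 8 * t ^ (-s) := by positivity
    rw [h2]
    linarith
  obtain ⟨ξ, hξ⟩ := exists_lt_norm_sq_of_lt_integral (by linarith) (hfint t ht0) hφ1 hzero hv
  refine ⟨ξ, ?_⟩
  refine (pow_le_pow_iff_left₀ (by positivity) (norm_nonneg _) two_ne_zero).1 ?_
  rw [mul_pow, Real.sq_sqrt (by positivity), ← Real.rpow_natCast (t ^ _), ← Real.rpow_mul ht0.le]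
  have e : -(5 / 4 * β) * ((2 : ℕ) : ℝ) = -s := by rw [hs]; push_cast; ring
  rw [e]
  exact hξ.le

end ProfileSolution

/-- The phase `((ξ + c₁)² / (4 c₂) - c₀)` generated by the linear flow along rays `x = t ξ`. -/
def rayPhase (c₂ c₁ c₀ ξ : ℝ) : ℝ := (ξ + c₁) ^ 2 / (4 * c₂) - c₀

lemma hasDerivAt_rayPhase (c₂ c₁ c₀ ξ : ℝ) :
    HasDerivAt (rayPhase c₂ c₁ c₀) ((ξ + c₁) / (2 * c₂)) ξ := by
  have h1 : HasDerivAt (fun x => (x + c₁) ^ 2 / (4 * c₂) - c₀)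
      ((2 * (ξ + c₁) ^ (2 - 1) * 1) / (4 * c₂)) ξ :=
    ((((hasDerivAt_id ξ).add_const c₁).pow 2).div_const (4 * c₂)).sub_const c₀
  refine HasDerivAt.congr_deriv (f := rayPhase c₂ c₁ c₀) h1 ?_
  rcases eq_or_ne c₂ 0 with rfl | hc
  · simp
  · field_simp; norm_num; ring

/-- The modulating factor `√t e^{i t q}`. -/
def rayFactor (q t : ℝ) : ℂ := (√t : ℂ) * Complex.exp (Complex.I * ((t * q : ℝ) : ℂ))

lemma norm_rayFactor (q t : ℝ) : ‖rayFactor q t‖ = √t := by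
  rw [rayFactor, norm_mul, mul_comm Complex.I, Complex.norm_exp_ofReal_mul_I, mul_one,
    Complex.norm_real, Real.norm_of_nonneg (Real.sqrt_nonneg t)]

lemma hasDerivAt_rayFactor_time {q t : ℝ} (ht : 0 < t) :
    HasDerivAt (rayFactor q) (rayFactor q t * ((((2 * t)⁻¹ : ℝ) : ℂ) + Complex.I * (q : ℂ))) t := by
  have h1 : HasDerivAt (fun s => ((√s : ℝ) : ℂ)) ((1 / (2 * √t) : ℝ) : ℂ) t :=
    (Real.hasDerivAt_sqrt ht.ne').ofReal_comp
  have h2 : HasDerivAt (fun s => Complex.exp (Complex.I * ((s * q : ℝ) : ℂ)))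
      (Complex.exp (Complex.I * ((t * q : ℝ) : ℂ)) * (Complex.I * ((1 * q : ℝ) : ℂ))) t :=
    ((((hasDerivAt_id t).mul_const q).ofReal_comp).const_mul Complex.I).cexp
  refine HasDerivAt.congr_deriv (f := rayFactor q) (h1.mul h2) ?_
  have h3 : (1 / (2 * √t) : ℝ) = √t * (2 * t)⁻¹ := by
    have := Real.sq_sqrt ht.le
    have h4 : √t ≠ 0 := (Real.sqrt_pos.2 ht).ne'
    field_simp
    exact this.symm
  rw [h3, rayFactor]
  push_cast
  ring

lemma hasDerivAt_rayFactor_space {q : ℝ → ℝ} {q' t ξ : ℝ} (hq : HasDerivAt q q' ξ) :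
    HasDerivAt (fun x => rayFactor (q x) t) (rayFactor (q ξ) t * (Complex.I * ((t * q' : ℝ) : ℂ)))
      ξ := by
  have h2 : HasDerivAt (fun x => Complex.exp (Complex.I * ((t * q x : ℝ) : ℂ)))
      (Complex.exp (Complex.I * ((t * q ξ : ℝ) : ℂ)) * (Complex.I * ((t * q' : ℝ) : ℂ))) ξ :=
    (((hq.const_mul t).ofReal_comp).const_mul Complex.I).cexp
  refine HasDerivAt.congr_deriv (f := fun x => rayFactor (q x) t) (h2.const_mul (√t : ℂ)) ?_
  rw [rayFactor]
  ring

namespace SchwartzSolution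

variable {c₂ c₁ c₀ α : ℝ} {lam : ℂ} {u : ℝ → ℝ → ℂ}

lemma domain_mem_nhds {t : ℝ} (ht : 0 < t) (x : ℝ) :
    Ici (0 : ℝ) ×ˢ (univ : Set ℝ) ∈ nhds (t, x) :=
  prod_mem_nhds (Ici_mem_nhds ht) univ_mem

lemma hasDerivAt_time (sol : SchwartzSolution c₂ c₁ c₀ α lam u) {t : ℝ} (ht : 0 < t) (x : ℝ) :
    HasDerivAt (fun s => u s x) (sol.ut t x) t :=
  (sol.hut x t ht.le).hasDerivAt (Ici_mem_nhds ht)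

/-- Differentiation in time along a ray. -/
lemma hasDerivAt_ray (sol : SchwartzSolution c₂ c₁ c₀ α lam u) {t : ℝ} (ht : 0 < t) (ξ : ℝ) :
    HasDerivAt (fun s => u s (s * ξ)) (sol.ut t (t * ξ) + (ξ : ℂ) * sol.ux t (t * ξ)) t := by
  have hev : ∀ᶠ v : ℝ × ℝ in nhds (t, t * ξ), 0 < v.1 :=
    continuousAt_fst.eventually_const_lt ht
  have hF := hasStrictFDerivAt_uncurry_coprod (𝕜 := ℝ) (u := (t, t * ξ)) (f := u)
    (f₁ := fun s x => ContinuousLinearMap.toSpanSingleton ℝ (sol.ut s x))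
    (f₂ := fun s x => ContinuousLinearMap.toSpanSingleton ℝ (sol.ux s x))
    (hev.mono fun v hv => (sol.hasDerivAt_time hv v.2).hasFDerivAt)
    (hev.mono fun v hv => (sol.hux v.1 hv.le v.2).hasFDerivAt)
    ((ContinuousLinearMap.toSpanSingletonCLE (𝕜 := ℝ) (E := ℂ)).continuous.continuousAt.comp
      (sol.hut_cont.continuousAt (domain_mem_nhds ht _)))
    ((ContinuousLinearMap.toSpanSingletonCLE (𝕜 := ℝ) (E := ℂ)).continuous.continuousAt.comp
      (sol.hux_cont.continuousAt (domain_mem_nhds ht _)))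
  have hg : HasDerivAt (fun s : ℝ => (s, s * ξ)) (1, 1 * ξ) t :=
    (hasDerivAt_id t).prodMk ((hasDerivAt_id t).mul_const ξ)
  have := hF.hasFDerivAt.comp_hasDerivAt t hg
  refine HasDerivAt.congr_deriv (f := fun s => u s (s * ξ)) this ?_
  simp [Function.HasUncurry.uncurry]

/-- A combination of the solution and its derivatives along a ray, with a modulating factor. -/
def rayCombination (sol : SchwartzSolution c₂ c₁ c₀ α lam u) (a₀ a₁ a₂ a₃ : ℂ) (t ξ : ℝ) : ℂ :=
  rayFactor (rayPhase c₂ c₁ c₀ ξ) t * (a₀ * u t (t * ξ) + a₁ * sol.ut t (t * ξ)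
    + a₂ * sol.ux t (t * ξ) + a₃ * sol.uxx t (t * ξ))

/-- The profile of the solution along rays. -/
def profile (sol : SchwartzSolution c₂ c₁ c₀ α lam u) (t ξ : ℝ) : ℂ :=
  sol.rayCombination 1 0 0 0 t ξ

/-- The time derivative of the profile. -/
def profileTime (sol : SchwartzSolution c₂ c₁ c₀ α lam u) (t ξ : ℝ) : ℂ :=
  sol.rayCombination ((((2 * t)⁻¹ : ℝ) : ℂ) + Complex.I * (rayPhase c₂ c₁ c₀ ξ : ℂ)) 1 (ξ : ℂ) 0
    t ξ

/-- The space derivative of the profile. -/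
def profileSpace (sol : SchwartzSolution c₂ c₁ c₀ α lam u) (t ξ : ℝ) : ℂ :=
  sol.rayCombination (Complex.I * ((t * ((ξ + c₁) / (2 * c₂)) : ℝ) : ℂ)) 0 (t : ℂ) 0 t ξ

/-- The second space derivative of the profile. -/
def profileSpace₂ (sol : SchwartzSolution c₂ c₁ c₀ α lam u) (t ξ : ℝ) : ℂ :=
  sol.rayCombination (-((t * ((ξ + c₁) / (2 * c₂)) : ℝ) : ℂ) ^ 2
      + Complex.I * ((t * (1 / (2 * c₂)) : ℝ) : ℂ)) 0
    (2 * Complex.I * (t : ℂ) * ((t * ((ξ + c₁) / (2 * c₂)) : ℝ) : ℂ)) ((t : ℂ) ^ 2) t ξ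

lemma norm_profile (sol : SchwartzSolution c₂ c₁ c₀ α lam u) (t ξ : ℝ) :
    ‖sol.profile t ξ‖ = √t * ‖u t (t * ξ)‖ := by
  simp [profile, rayCombination, norm_rayFactor]

lemma norm_profile_rpow (sol : SchwartzSolution c₂ c₁ c₀ α lam u) {t : ℝ} (ht : 0 < t) (ξ : ℝ) :
    t ^ (-(α / 2)) * ‖sol.profile t ξ‖ ^ α = ‖u t (t * ξ)‖ ^ α := by
  rw [norm_profile, Real.mul_rpow (by positivity) (by positivity), Real.sqrt_eq_rpow,
    ← Real.rpow_mul ht.le, ← mul_assoc, ← Real.rpow_add ht]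
  have : -(α / 2) + 1 / 2 * α = 0 := by ring
  rw [this, Real.rpow_zero, one_mul]

lemma norm_rayCombination_le (sol : SchwartzSolution c₂ c₁ c₀ α lam u) {a₀ a₁ a₂ a₃ : ℂ}
    {A t : ℝ} (ξ : ℝ) (h₀ : ‖a₀‖ ≤ A) (h₁ : ‖a₁‖ ≤ A) (h₂ : ‖a₂‖ ≤ A) (h₃ : ‖a₃‖ ≤ A) :
    ‖sol.rayCombination a₀ a₁ a₂ a₃ t ξ‖ ≤ √t * A * (‖u t (t * ξ)‖ + ‖sol.ut t (t * ξ)‖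
      + ‖sol.ux t (t * ξ)‖ + ‖sol.uxx t (t * ξ)‖) := by
  rw [rayCombination, norm_mul, norm_rayFactor, mul_assoc]
  gcongr
  refine (norm_add_le _ _).trans ?_
  refine (add_le_add_left ((norm_add_le _ _).trans (add_le_add_left (norm_add_le _ _) _)) _).trans ?_
  simp only [norm_mul, mul_add]
  gcongr

lemma continuousAt_ray {f : ℝ → ℝ → ℂ}
    (hf : ContinuousOn (fun p : ℝ × ℝ => f p.1 p.2) (Ici 0 ×ˢ univ)) {t : ℝ} (ht : 0 < t) (ξ : ℝ) :
    ContinuousAt (fun p : ℝ × ℝ => f p.1 (p.1 * p.2)) (t, ξ) :=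
  (hf.continuousAt (domain_mem_nhds ht (t * ξ))).comp
    (f := fun p : ℝ × ℝ => (p.1, p.1 * p.2)) (x := (t, ξ)) (by fun_prop)

lemma continuousAt_rayCombination (sol : SchwartzSolution c₂ c₁ c₀ α lam u)
    {a₀ a₁ a₂ a₃ : ℝ → ℝ → ℂ} {t ξ : ℝ} (ht : 0 < t)
    (h₀ : ContinuousAt (fun p : ℝ × ℝ => a₀ p.1 p.2) (t, ξ))
    (h₁ : ContinuousAt (fun p : ℝ × ℝ => a₁ p.1 p.2) (t, ξ))
    (h₂ : ContinuousAt (fun p : ℝ × ℝ => a₂ p.1 p.2) (t, ξ))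
    (h₃ : ContinuousAt (fun p : ℝ × ℝ => a₃ p.1 p.2) (t, ξ)) :
    ContinuousAt (fun p : ℝ × ℝ => sol.rayCombination (a₀ p.1 p.2) (a₁ p.1 p.2) (a₂ p.1 p.2)
      (a₃ p.1 p.2) p.1 p.2) (t, ξ) := by
  have hF : Continuous fun p : ℝ × ℝ => rayFactor (rayPhase c₂ c₁ c₀ p.2) p.1 := by
    unfold rayFactor rayPhase
    fun_prop
  exact hF.continuousAt.mul ((((h₀.mul (continuousAt_ray sol.hu_cont ht ξ)).add
    (h₁.mul (continuousAt_ray sol.hut_cont ht ξ))).add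
    (h₂.mul (continuousAt_ray sol.hux_cont ht ξ))).add
    (h₃.mul (continuousAt_ray sol.huxx_cont ht ξ)))

lemma hasDerivAt_profile_time (sol : SchwartzSolution c₂ c₁ c₀ α lam u) {t : ℝ} (ht : 0 < t)
    (ξ : ℝ) : HasDerivAt (fun s => sol.profile s ξ) (sol.profileTime t ξ) t := by
  have h1 := (hasDerivAt_rayFactor_time (q := rayPhase c₂ c₁ c₀ ξ) ht).mul
    (sol.hasDerivAt_ray ht ξ)
  refine (h1.congr_deriv ?_).congr_of_eventuallyEq (Eventually.of_forall fun s => ?_)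
  · rw [profileTime, rayCombination]; ring
  · simp [profile, rayCombination]

lemma hasDerivAt_scale {f : ℝ → ℂ} {f' : ℂ} {t ξ : ℝ} (hf : HasDerivAt f f' (t * ξ)) :
    HasDerivAt (fun x => f (t * x)) ((t : ℂ) * f') ξ := by
  have h1 : HasDerivAt (fun x => t * x) (t * 1) ξ := (hasDerivAt_id ξ).const_mul t
  have := hf.scomp ξ h1
  refine this.congr_deriv ?_
  rw [mul_one, Complex.real_smul]

lemma hasDerivAt_profile_space (sol : SchwartzSolution c₂ c₁ c₀ α lam u) {t : ℝ} (ht : 0 < t)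
    (ξ : ℝ) : HasDerivAt (sol.profile t) (sol.profileSpace t ξ) ξ := by
  have h1 := (hasDerivAt_rayFactor_space (t := t) (hasDerivAt_rayPhase c₂ c₁ c₀ ξ)).mul
    (hasDerivAt_scale (sol.hux t ht.le (t * ξ)))
  refine (h1.congr_deriv ?_).congr_of_eventuallyEq (Eventually.of_forall fun s => ?_)
  · rw [profileSpace, rayCombination]; ring
  · simp [profile, rayCombination]

lemma hasDerivAt_profile_space₂ (sol : SchwartzSolution c₂ c₁ c₀ α lam u) {t : ℝ} (ht : 0 < t)
    (ξ : ℝ) : HasDerivAt (sol.profileSpace t) (sol.profileSpace₂ t ξ) ξ := by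
  have hq : HasDerivAt (fun x => Complex.I * ((t * ((x + c₁) / (2 * c₂)) : ℝ) : ℂ))
      (Complex.I * ((t * (1 / (2 * c₂)) : ℝ) : ℂ)) ξ :=
    ((((((hasDerivAt_id ξ).add_const c₁).div_const (2 * c₂))).const_mul t).ofReal_comp).const_mul _
  have h1 := (hasDerivAt_rayFactor_space (t := t) (hasDerivAt_rayPhase c₂ c₁ c₀ ξ)).mul
    ((hq.mul (hasDerivAt_scale (sol.hux t ht.le (t * ξ)))).add
      ((hasDerivAt_scale (sol.huxx t ht.le (t * ξ))).const_mul (t : ℂ)))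
  refine (h1.congr_deriv ?_).congr_of_eventuallyEq (Eventually.of_forall fun s => ?_)
  · rw [profileSpace₂, rayCombination]
    simp only [Pi.add_apply, Pi.mul_apply]
    linear_combination (rayFactor (rayPhase c₂ c₁ c₀ ξ) t) *
      ((t * ((ξ + c₁) / (2 * c₂)) : ℝ) : ℂ) ^ 2 * u t (t * ξ) * Complex.I_sq
  · simp [profileSpace, rayCombination]

lemma profile_equation (sol : SchwartzSolution c₂ c₁ c₀ α lam u) (hc : 0 < c₂) {t : ℝ}
    (ht : 0 < t) (ξ : ℝ) :
    sol.profileTime t ξ = (c₂ * (t ^ 2)⁻¹ : ℝ) * (-Complex.I * sol.profileSpace₂ t ξ)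
      + (t ^ (-(α / 2)) : ℝ) *
        (Complex.I * lam * (((‖sol.profile t ξ‖ ^ α : ℝ) : ℂ) * sol.profile t ξ)) := by
  have heq := sol.heq t ht (t * ξ)
  have hN' : ((t ^ (-(α / 2)) : ℝ) : ℂ) * ((‖sol.profile t ξ‖ ^ α : ℝ) : ℂ) =
      ((‖u t (t * ξ)‖ ^ α : ℝ) : ℂ) := by
    rw [← sol.norm_profile_rpow ht]; push_cast; ring
  have e1 : ((t ^ (-(α / 2)) : ℝ) : ℂ) *
        (Complex.I * lam * (((‖sol.profile t ξ‖ ^ α : ℝ) : ℂ) * sol.profile t ξ)) =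
      Complex.I * lam * ((‖u t (t * ξ)‖ ^ α : ℝ) : ℂ) * sol.profile t ξ := by
    rw [← hN']; ring
  rw [e1, profileTime, profileSpace₂, profile, rayCombination, rayCombination, rayCombination,
    rayPhase]
  have htc : (t : ℂ) ≠ 0 := by exact_mod_cast ht.ne'
  have hcc : (c₂ : ℂ) ≠ 0 := by exact_mod_cast hc.ne'
  have hut : sol.ut t (t * ξ) = Complex.I * (lam * Complex.ofReal (‖u t (t * ξ)‖ ^ α) * u t (t * ξ))
      - Complex.I * (c₂ : ℂ) * sol.uxx t (t * ξ) + (c₁ : ℂ) * sol.ux t (t * ξ)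
      + Complex.I * (c₀ : ℂ) * u t (t * ξ) := by
    linear_combination Complex.I * heq + (sol.ut t (t * ξ) - c₁ * sol.ux t (t * ξ)) * Complex.I_sq
  rw [hut]
  set F := rayFactor ((ξ + c₁) ^ 2 / (4 * c₂) - c₀) t
  push_cast
  field_simp
  ring_nf
  simp only [Complex.I_sq]
  ring

lemma exists_rayPhase_bound (hc : 0 < c₂) : ∃ Q : ℝ, 1 ≤ Q ∧ 1 / (2 * c₂) ≤ Q ∧
    (∀ ξ : ℝ, |(ξ + c₁) / (2 * c₂)| ≤ Q * (1 + |ξ|)) ∧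
    ∀ ξ : ℝ, |rayPhase c₂ c₁ c₀ ξ| ≤ Q * (1 + |ξ|) ^ 2 := by
  have p1 : 0 ≤ (1 + |c₁|) / (2 * c₂) := by positivity
  have p2 : 0 ≤ (1 + |c₁|) ^ 2 / (4 * c₂) := by positivity
  have p3 := abs_nonneg c₀
  have p4 : 1 / (2 * c₂) ≤ (1 + |c₁|) / (2 * c₂) := by
    gcongr; linarith [abs_nonneg c₁]
  have h1 : ∀ ξ, |ξ + c₁| ≤ (1 + |c₁|) * (1 + |ξ|) := fun ξ => by
    nlinarith [abs_add_le ξ c₁, abs_nonneg ξ, abs_nonneg c₁,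
      mul_nonneg (abs_nonneg ξ) (abs_nonneg c₁)]
  refine ⟨1 + (1 + |c₁|) / (2 * c₂) + (1 + |c₁|) ^ 2 / (4 * c₂) + |c₀|, by linarith, by linarith,
    fun ξ => ?_, fun ξ => ?_⟩
  · rw [abs_div, abs_of_pos (by positivity : 0 < 2 * c₂)]
    calc |ξ + c₁| / (2 * c₂) ≤ (1 + |c₁|) * (1 + |ξ|) / (2 * c₂) := by gcongr; exact h1 ξ
      _ = (1 + |c₁|) / (2 * c₂) * (1 + |ξ|) := by ring
      _ ≤ _ := by gcongr; linarith
  · have h2 : (ξ + c₁) ^ 2 ≤ ((1 + |c₁|) * (1 + |ξ|)) ^ 2 := by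
      rw [← sq_abs (ξ + c₁)]; gcongr; exact h1 ξ
    have h3 : 1 ≤ (1 + |ξ|) ^ 2 := by nlinarith [abs_nonneg ξ]
    rw [rayPhase]
    refine (abs_sub _ _).trans ?_
    rw [abs_of_nonneg (by positivity : 0 ≤ (ξ + c₁) ^ 2 / (4 * c₂))]
    have h4 : (ξ + c₁) ^ 2 / (4 * c₂) ≤ (1 + |c₁|) ^ 2 / (4 * c₂) * (1 + |ξ|) ^ 2 := by
      rw [div_mul_eq_mul_div, ← mul_pow]; gcongr
    have h5 : |c₀| ≤ |c₀| * (1 + |ξ|) ^ 2 := le_mul_of_one_le_right p3 h3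
    have h6 : 0 ≤ (1 + (1 + |c₁|) / (2 * c₂)) * (1 + |ξ|) ^ 2 := by positivity
    linarith

set_option maxHeartbeats 800000 in
lemma profile_decay (sol : SchwartzSolution c₂ c₁ c₀ α lam u) (hc : 0 < c₂) {a : ℝ} (b : ℝ)
    (ha : 0 < a) : ∃ C, ∀ t ∈ Icc a b, ∀ ξ, (‖sol.profile t ξ‖ + ‖sol.profileTime t ξ‖
      + ‖sol.profileSpace t ξ‖ + ‖sol.profileSpace₂ t ξ‖) * (1 + ξ ^ 2) ≤ C := by
  obtain ⟨C, hC⟩ := sol.hdecay 4 (max b 1) (by positivity)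
  obtain ⟨Q, hQ1, hQc, hQ', hQ⟩ := exists_rayPhase_bound (c₁ := c₁) (c₀ := c₀) hc
  obtain ⟨τ, hτ⟩ : ∃ τ : ℝ, τ = 1 + |b| + 1 / a := ⟨_, rfl⟩
  have ha' : 0 < 1 / a := by positivity
  refine ⟨12 * τ ^ 3 * Q ^ 2 * (1 + 1 / a) ^ 4 * C, fun t ht ξ => ?_⟩
  have ht0 : 0 < t := ha.trans_le ht.1
  have htτ : t ≤ τ := by linarith [ht.2, le_abs_self b]
  have hτ1 : 1 ≤ τ := by linarith [abs_nonneg b]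
  have hsτ : √t ≤ τ := by
    rw [Real.sqrt_le_iff]; constructor <;> nlinarith
  have hiτ : (2 * t)⁻¹ ≤ τ := by
    have : (2 * t)⁻¹ ≤ 1 / a := by
      rw [one_div]; exact inv_anti₀ ha (by linarith [ht.1])
    linarith [abs_nonneg b]
  obtain ⟨y, hy⟩ : ∃ y : ℝ, y = 1 + |ξ| := ⟨_, rfl⟩
  have hy1 : 1 ≤ y := by linarith [abs_nonneg ξ]
  obtain ⟨Z, hZ⟩ : ∃ Z : ℝ, Z = τ * Q * y := ⟨_, rfl⟩
  have hQy : 1 ≤ Q * y := one_le_mul_of_one_le_of_one_le hQ1 hy1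
  have hτZ : τ ≤ Z := by rw [hZ, mul_assoc]; exact le_mul_of_one_le_right (by linarith) hQy
  have hZ1 : 1 ≤ Z := hτ1.trans hτZ
  have hZZ : Z ≤ Z ^ 2 := by nlinarith
  have htZ : t ≤ Z := htτ.trans hτZ
  have hξZ : |ξ| ≤ Z := by
    have h1 : y ≤ Z := by
      rw [hZ]; exact le_mul_of_one_le_left (by linarith) (one_le_mul_of_one_le_of_one_le hτ1 hQ1)
    linarith
  have hqZ : |rayPhase c₂ c₁ c₀ ξ| ≤ Z ^ 2 := by
    refine (hQ ξ).trans ?_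
    rw [hZ, mul_pow, ← hy]
    have h1 : Q ≤ τ * Q := le_mul_of_one_le_left (by linarith) hτ1
    have h2 : τ * Q ≤ (τ * Q) ^ 2 := by nlinarith
    gcongr
    exact h1.trans h2
  have hq'Z : |t * ((ξ + c₁) / (2 * c₂))| ≤ Z := by
    rw [abs_mul, abs_of_pos ht0, hZ, mul_assoc]
    rw [hy]
    exact mul_le_mul htτ (hQ' ξ) (abs_nonneg _) (by linarith)
  have hq''Z : |t * (1 / (2 * c₂))| ≤ Z := by
    rw [abs_mul, abs_of_pos ht0, hZ, mul_assoc, abs_of_pos (by positivity)]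
    refine mul_le_mul htτ (hQc.trans ?_) (by positivity) (by linarith)
    exact le_mul_of_one_le_right (by linarith) hy1
  set S : ℝ := ‖u t (t * ξ)‖ + ‖sol.ut t (t * ξ)‖ + ‖sol.ux t (t * ξ)‖ + ‖sol.uxx t (t * ξ)‖ with hS
  have hS0 : 0 ≤ S := by positivity
  have nR : ∀ r : ℝ, ‖(r : ℂ)‖ = |r| := fun r => by rw [Complex.norm_real, Real.norm_eq_abs]
  have n0 : ‖(0 : ℂ)‖ ≤ 3 * Z ^ 2 := by rw [norm_zero]; positivity
  have n1 : ‖(1 : ℂ)‖ ≤ 3 * Z ^ 2 := by rw [norm_one]; nlinarith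
  have b0 : ‖sol.profile t ξ‖ ≤ √t * (3 * Z ^ 2) * S :=
    sol.norm_rayCombination_le ξ n1 n0 n0 n0
  have b1 : ‖sol.profileTime t ξ‖ ≤ √t * (3 * Z ^ 2) * S := by
    refine sol.norm_rayCombination_le ξ ?_ n1 ?_ n0
    · refine (norm_add_le _ _).trans ?_
      rw [norm_mul, Complex.norm_I, one_mul, nR, nR, abs_of_pos (by positivity)]
      linarith
    · rw [nR]; linarith
  have b2 : ‖sol.profileSpace t ξ‖ ≤ √t * (3 * Z ^ 2) * S := by
    refine sol.norm_rayCombination_le ξ ?_ n0 ?_ n0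
    · rw [norm_mul, Complex.norm_I, one_mul, nR]; linarith
    · rw [nR, abs_of_pos ht0]; linarith
  have b3 : ‖sol.profileSpace₂ t ξ‖ ≤ √t * (3 * Z ^ 2) * S := by
    refine sol.norm_rayCombination_le ξ ?_ n0 ?_ ?_
    · refine (norm_add_le _ _).trans ?_
      rw [norm_mul, Complex.norm_I, one_mul, nR, norm_neg, norm_pow, nR]
      have : |t * ((ξ + c₁) / (2 * c₂))| ^ 2 ≤ Z ^ 2 := by gcongr
      linarith
    · rw [norm_mul, norm_mul, norm_mul, Complex.norm_I, nR, nR, mul_one, abs_of_pos ht0]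
      have : t * |t * ((ξ + c₁) / (2 * c₂))| ≤ Z * Z := by gcongr
      rw [Complex.norm_ofNat, mul_assoc]
      linarith [sq_nonneg Z, sq Z]
    · rw [norm_pow, nR, abs_of_pos ht0]
      have : t ^ 2 ≤ Z ^ 2 := by gcongr
      nlinarith
  have hyt : y ≤ (1 + 1 / a) * (1 + |t * ξ|) := by
    have h1 : |ξ| ≤ 1 / a * |t * ξ| := by
      rw [abs_mul, abs_of_pos ht0, ← mul_assoc]
      refine le_mul_of_one_le_left (abs_nonneg _) ?_
      rw [one_div, inv_mul_eq_div, one_le_div ha]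
      exact ht.1
    nlinarith [abs_nonneg (t * ξ)]
  have hdec : S * (1 + |t * ξ|) ^ 4 ≤ C :=
    hC t ⟨ht0.le, ht.2.trans (le_max_left _ _)⟩ (t * ξ)
  have hξy : 1 + ξ ^ 2 ≤ y ^ 2 := by nlinarith [abs_nonneg ξ, sq_abs ξ]
  calc (‖sol.profile t ξ‖ + ‖sol.profileTime t ξ‖
      + ‖sol.profileSpace t ξ‖ + ‖sol.profileSpace₂ t ξ‖) * (1 + ξ ^ 2)
      ≤ (4 * (τ * (3 * Z ^ 2) * S)) * y ^ 2 := by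
        have : √t * (3 * Z ^ 2) * S ≤ τ * (3 * Z ^ 2) * S := by gcongr
        gcongr
        linarith
    _ = 12 * τ ^ 3 * Q ^ 2 * (S * y ^ 4) := by rw [hZ]; ring
    _ ≤ 12 * τ ^ 3 * Q ^ 2 * (S * ((1 + 1 / a) * (1 + |t * ξ|)) ^ 4) := by gcongr
    _ = 12 * τ ^ 3 * Q ^ 2 * (1 + 1 / a) ^ 4 * (S * (1 + |t * ξ|) ^ 4) := by ring
    _ ≤ _ := by gcongr

lemma profileSolution (sol : SchwartzSolution c₂ c₁ c₀ α lam u) (hc : 0 < c₂) :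
    ProfileSolution c₂ α lam sol.profile sol.profileTime sol.profileSpace sol.profileSpace₂ where
  hasDerivAt_time t ht x := sol.hasDerivAt_profile_time ht x
  hasDerivAt_space t ht x := sol.hasDerivAt_profile_space ht x
  hasDerivAt_space₂ t ht x := sol.hasDerivAt_profile_space₂ ht x
  continuousAt_time t ht x := by
    refine sol.continuousAt_rayCombination (a₀ := fun t ξ => (((2 * t)⁻¹ : ℝ) : ℂ)
      + Complex.I * (rayPhase c₂ c₁ c₀ ξ : ℂ)) (a₁ := fun _ _ => 1) (a₂ := fun _ ξ => (ξ : ℂ))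
      (a₃ := fun _ _ => 0) ht ?_ (by fun_prop) (by fun_prop) (by fun_prop)
    refine ContinuousAt.add (Complex.continuous_ofReal.continuousAt.comp
      (f := fun p : ℝ × ℝ => (2 * p.1)⁻¹) (ContinuousAt.inv₀ (by fun_prop) ?_)) ?_
    · simp [ht.ne']
    · unfold rayPhase
      fun_prop
  continuousAt_space₂ t ht x := by
    refine sol.continuousAt_rayCombination
      (a₀ := fun t ξ => -((t * ((ξ + c₁) / (2 * c₂)) : ℝ) : ℂ) ^ 2
        + Complex.I * ((t * (1 / (2 * c₂)) : ℝ) : ℂ)) (a₁ := fun _ _ => 0)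
      (a₂ := fun t ξ => 2 * Complex.I * (t : ℂ) * ((t * ((ξ + c₁) / (2 * c₂)) : ℝ) : ℂ))
      (a₃ := fun t _ => (t : ℂ) ^ 2) ht ?_ (by fun_prop) ?_ ?_ <;> fun_prop
  decay a b ha := sol.profile_decay hc b ha
  equation t ht x := sol.profile_equation hc ht x

lemma exists_norm_le (sol : SchwartzSolution c₂ c₁ c₀ α lam u) {T : ℝ} (hT : 0 < T) :
    ∃ B, 0 ≤ B ∧ ∀ t ∈ Icc 0 T, ∀ x, ‖u t x‖ ≤ B := by
  obtain ⟨C, hC⟩ := sol.hdecay 0 T hT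
  refine ⟨|C|, abs_nonneg C, fun t ht x => ?_⟩
  have := hC t ht x
  rw [pow_zero, mul_one] at this
  linarith [le_abs_self C, norm_nonneg (sol.ut t x), norm_nonneg (sol.ux t x),
    norm_nonneg (sol.uxx t x)]

lemma continuous_space (sol : SchwartzSolution c₂ c₁ c₀ α lam u) {t : ℝ} (ht : 0 ≤ t) :
    Continuous (u t) :=
  continuous_iff_continuousAt.2 fun x => (sol.hux t ht x).continuousAt

lemma exists_norm_sq_le (sol : SchwartzSolution c₂ c₁ c₀ α lam u) {T : ℝ} (hT : 0 < T) :
    ∃ C, ∀ t ∈ Icc 0 T, ∀ x, ‖u t x‖ ^ 2 ≤ C * (1 + x ^ 2)⁻¹ := by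
  obtain ⟨C, hC⟩ := sol.hdecay 1 T hT
  refine ⟨C ^ 2, fun t ht x => ?_⟩
  have h1 : ‖u t x‖ * (1 + |x|) ≤ C := by
    have := hC t ht x
    rw [pow_one] at this
    refine le_trans ?_ this
    gcongr
    linarith [norm_nonneg (sol.ut t x), norm_nonneg (sol.ux t x), norm_nonneg (sol.uxx t x)]
  rw [← div_eq_mul_inv, le_div_iff₀ (by positivity)]
  calc ‖u t x‖ ^ 2 * (1 + x ^ 2) ≤ ‖u t x‖ ^ 2 * (1 + |x|) ^ 2 := by
        gcongr; nlinarith [abs_nonneg x, sq_abs x]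
    _ = (‖u t x‖ * (1 + |x|)) ^ 2 := by ring
    _ ≤ C ^ 2 := by gcongr

lemma continuousOn_mass (sol : SchwartzSolution c₂ c₁ c₀ α lam u) {T : ℝ} (hT : 0 < T) :
    ContinuousOn (fun t => ∫ x, ‖u t x‖ ^ 2) (Icc 0 T) := by
  obtain ⟨C, hC⟩ := sol.exists_norm_sq_le hT
  refine continuousOn_of_dominated (bound := fun x => C * (1 + x ^ 2)⁻¹) (fun t ht => ?_)
    (fun t ht => ae_of_all _ fun x => ?_) (integrable_inv_one_add_sq.const_mul C)
    (ae_of_all _ fun x t ht => ?_)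
  · have := sol.continuous_space ht.1
    exact Continuous.aestronglyMeasurable (by fun_prop)
  · rw [Real.norm_of_nonneg (by positivity)]
    exact hC t ht x
  · exact (((sol.hut x t ht.1).continuousWithinAt).mono fun s hs => hs.1).norm.pow 2

lemma mass_pos (sol : SchwartzSolution c₂ c₁ c₀ α lam u) (hu0 : ∃ x, u 0 x ≠ 0) :
    0 < ∫ x, ‖u 0 x‖ ^ 2 := by
  obtain ⟨x, hx⟩ := hu0
  obtain ⟨C, hC⟩ := sol.exists_norm_sq_le one_pos
  have hcont := sol.continuous_space le_rfl
  have hcont' : Continuous fun x => ‖u 0 x‖ ^ 2 := by fun_prop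
  refine integral_pos_of_integrable_nonneg_nonzero (x := x) hcont' ?_ (fun x => by positivity) ?_
  · refine (integrable_inv_one_add_sq.const_mul C).mono' hcont'.aestronglyMeasurable
      (ae_of_all _ fun x => ?_)
    rw [Real.norm_of_nonneg (by positivity)]
    exact hC 0 ⟨le_rfl, zero_le_one⟩ x
  · simpa using hx

lemma integral_norm_profile_sq (sol : SchwartzSolution c₂ c₁ c₀ α lam u) {t : ℝ} (ht : 0 < t) :
    ∫ ξ, ‖sol.profile t ξ‖ ^ 2 = ∫ x, ‖u t x‖ ^ 2 := by
  simp only [norm_profile, mul_pow, Real.sq_sqrt ht.le]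
  rw [integral_const_mul, Measure.integral_comp_mul_left (fun x => ‖u t x‖ ^ 2) t,
    abs_of_pos (by positivity), smul_eq_mul, mul_inv_cancel_left₀ ht.ne']

/-- A nontrivial solution never vanishes, as its mass decays at most exponentially. -/
lemma exists_ne_zero (sol : SchwartzSolution c₂ c₁ c₀ α lam u) (hα : 0 < α) (hc : 0 < c₂)
    (hlam0 : 0 < lam.im) (hu0 : ∃ x, u 0 x ≠ 0) {T : ℝ} (hT : 0 < T) : ∃ x, u T x ≠ 0 := by
  obtain ⟨B, hB0, hB⟩ := sol.exists_norm_le hT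
  have h := sol.profileSolution hc
  set M : ℝ → ℝ := fun t => ∫ x, ‖u t x‖ ^ 2 with hM
  set D : ℝ → ℝ := fun t => -(2 * lam.im * t ^ (-(α / 2)) *
    ∫ ξ, ‖sol.profile t ξ‖ ^ α * ‖sol.profile t ξ‖ ^ 2) with hD
  set K : ℝ := 2 * lam.im * B ^ α with hK
  have hder : ∀ t, 0 < t → HasDerivAt M (D t) t := fun t ht =>
    (h.hasDerivAt_mass hα hc ht).congr_of_eventuallyEq <| by
      filter_upwards [lt_mem_nhds ht] with s hs
      exact (sol.integral_norm_profile_sq hs).symm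
  have hDM : ∀ t ∈ Ioo 0 T, 0 ≤ D t + K * M t := by
    intro t ht
    have hle : t ^ (-(α / 2)) * ∫ ξ, ‖sol.profile t ξ‖ ^ α * ‖sol.profile t ξ‖ ^ 2 ≤
        B ^ α * M t := by
      rw [show M t = ∫ ξ, ‖sol.profile t ξ‖ ^ 2 from (sol.integral_norm_profile_sq ht.1).symm,
        ← integral_const_mul, ← integral_const_mul]
      refine integral_mono ((h.integrable_norm_rpow_mul_norm_sq hα ht.1).const_mul _)
        ((h.integrable_norm_sq ht.1).const_mul _) fun ξ => ?_
      simp only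
      rw [← mul_assoc, sol.norm_profile_rpow ht.1]
      gcongr
      exact hB t ⟨ht.1.le, ht.2.le⟩ _
    have := mul_le_mul_of_nonneg_left hle (by positivity : 0 ≤ 2 * lam.im)
    simp only [hD, hK]
    linarith
  have hmono : MonotoneOn (fun t => rexp (K * t) * M t) (Icc 0 T) := by
    refine monotoneOn_of_hasDerivWithinAt_nonneg (convex_Icc 0 T)
      (f' := fun t => rexp (K * t) * (K * 1) * M t + rexp (K * t) * D t) ?_ (fun t ht => ?_)
      fun t ht => ?_
    · exact ContinuousOn.mul (by fun_prop) (sol.continuousOn_mass hT)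
    · rw [interior_Icc] at ht
      exact ((((hasDerivAt_id t).const_mul K).exp).mul (hder t ht.1)).hasDerivWithinAt
    · rw [interior_Icc] at ht
      have := mul_nonneg (Real.exp_pos (K * t)).le (hDM t ht)
      linarith
  have hfin := hmono ⟨le_rfl, hT.le⟩ ⟨hT.le, le_rfl⟩ hT.le
  by_contra! hzero
  have hMT : M T = 0 := by simp [hM, hzero]
  simp only [hMT, mul_zero, Real.exp_zero, one_mul] at hfin
  exact (sol.mass_pos hu0).not_ge hfin

end SchwartzSolution

lemma sqrt_rpow_neg_eq {α L : ℝ} (hα : 0 < α) (hα2 : α < 2) (hL : 0 < L) :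
    √((α * L / (1 - α / 2)) ^ (-(2 / α))) = ((2 - α) / (2 * α * L)) ^ (1 / α) := by
  have h1 : 0 < 1 - α / 2 := by linarith
  have h2 : (2 - α) / (2 * α * L) = (α * L / (1 - α / 2))⁻¹ := by
    field_simp
  rw [h2, Real.inv_rpow (by positivity), ← Real.rpow_neg (by positivity), Real.sqrt_eq_rpow,
    ← Real.rpow_mul (by positivity)]
  congr 1
  ring

/-- For `(5+√89)/8 < α < 2`, `λ` satisfying the large-dissipation
condition, and a nontrivial initial datum, the limit
`lim_{t→∞} t^{1/α} sup_x |u(t,x)| = ((2−α)/(2αλ₂))^{1/α}` holds; in particular the limit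
is independent of the initial datum. -/
theorem sharp_decay_limit (c₂ c₁ c₀ α : ℝ) (hc₂ : 0 < c₂)
    (hα1 : (5 + Real.sqrt 89) / 8 < α) (hα2 : α < 2)
    (lam : ℂ) (hlam0 : 0 < lam.im)
    (hlam : α * |lam.re| / (2 * Real.sqrt (α + 1)) ≤ lam.im)
    (u : ℝ → ℝ → ℂ) (sol : SchwartzSolution c₂ c₁ c₀ α lam u)
    (hu0 : ∃ x : ℝ, u 0 x ≠ 0) :
    Tendsto (fun t : ℝ => t ^ (1/α) * ⨆ x : ℝ, ‖u t x‖) atTop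
      (nhds (((2 - α) / (2 * α * lam.im)) ^ (1/α))) := by
  have h89 : (9.4 : ℝ) < √89 := Real.lt_sqrt_of_sq_lt (by norm_num)
  have hα : 1.8 < α := by linarith
  have hα' : 1 < α := by linarith
  have hα0 : 0 < α := by linarith
  obtain ⟨β, hβdef⟩ : ∃ β : ℝ, β = 1 / α - 1 / 2 := ⟨_, rfl⟩
  have hβ : α * β = 1 - α / 2 := by rw [hβdef]; field_simp
  have hβ2 : β < 1 / 16 := by nlinarith
  have h := sol.profileSolution hc₂
  have hnorm : ∀ t, 0 < t → ∀ ξ, t ^ β * ‖sol.profile t ξ‖ = t ^ (1 / α) * ‖u t (t * ξ)‖ := by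
    intro t ht ξ
    rw [sol.norm_profile, ← mul_assoc, Real.sqrt_eq_rpow, ← Real.rpow_add ht, hβdef,
      sub_add_cancel]
  have hne : ∀ t, 0 < t → ∃ ξ, sol.profile t ξ ≠ 0 := by
    intro t ht
    obtain ⟨x, hx⟩ := sol.exists_ne_zero hα0 hc₂ hlam0 hu0 ht
    refine ⟨x / t, fun h0 => hx ?_⟩
    have := sol.norm_profile t (x / t)
    rw [h0, norm_zero, mul_div_cancel₀ _ ht.ne', eq_comm, mul_eq_zero] at this
    exact norm_eq_zero.1 (this.resolve_left (Real.sqrt_pos.2 ht).ne')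
  obtain ⟨r, hr, hrough⟩ := h.exists_rough_lower_bound hα' hα2 hc₂ hlam0 hlam hβ hβ2 hne
  rw [← sqrt_rpow_neg_eq hα0 hα2 hlam0, Metric.tendsto_atTop']
  intro ε hε
  have hε2 : 0 < ε / 2 := by positivity
  have hup := h.eventually_norm_le hα' hα2 hc₂ hlam0 hlam hβ hβ2 hε2
  have hlo := h.eventually_le_norm_of_rough hα' hα2 hc₂ hlam0 hlam hβ hβ2 hε2 hr hrough
  obtain ⟨N, hN⟩ := eventually_atTop.1 (hup.and (hlo.and (eventually_gt_atTop 0)))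
  refine ⟨N, fun t ht => ?_⟩
  obtain ⟨hup, ⟨ξ, hξ⟩, ht0⟩ := hN t ht.le
  obtain ⟨B, -, hB⟩ := sol.exists_norm_le ht0
  have hbdd : BddAbove (range fun x => ‖u t x‖) :=
    ⟨B, by rintro _ ⟨x, rfl⟩; exact hB t ⟨ht0.le, le_rfl⟩ x⟩
  have htp : 0 < t ^ (1 / α) := Real.rpow_pos_of_pos ht0 _
  have hU : t ^ (1 / α) * ⨆ x, ‖u t x‖ ≤
      √((α * lam.im / (1 - α / 2)) ^ (-(2 / α))) + ε / 2 := by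
    rw [Real.mul_iSup_of_nonneg htp.le]
    refine ciSup_le fun x => ?_
    have := hup (x / t)
    rwa [hnorm t ht0, mul_div_cancel₀ _ ht0.ne'] at this
  have hL : √((α * lam.im / (1 - α / 2)) ^ (-(2 / α))) - ε / 2 ≤
      t ^ (1 / α) * ⨆ x, ‖u t x‖ := by
    rw [hnorm t ht0] at hξ
    exact hξ.trans (mul_le_mul_of_nonneg_left (le_ciSup hbdd (t * ξ)) htp.le)
  rw [Real.dist_eq, abs_lt]
  constructor <;> linarith

end
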